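/- Let G be a loopless multigraph, let k be a positive integer, and let S_1, S_2, S_3 ⊆ V(G) be pairwise vertex-disjoint sets, each of which is 9k-edge-connected in G. Then there exists a packing of k pairwise edge-disjoint (S_1, S_2, S_3)-forests in G. -/

import Mathlib

/-!
Multigraphs are modelled by a vertex type `V`, an edge type `E`, and an
incidence map `ends : E → Sym2 V` giving the (unordered) pair of endpoints
of each edge.  Subgraphs are identified with their edge sets (`Set E`).
-/

namespace SteinerPacking

variable {V E : Type}

/-- The set of edges incident to a vertex `u` (denoted `E(u)` in the paper). -/
def incEdges (ends : E → Sym2 V) (u : V) : Set E := {e | u ∈ ends e}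

/-- The degree `d(u) = |E(u)|` of a vertex. -/
noncomputable def deg (ends : E → Sym2 V) (u : V) : ℕ := (incEdges ends u).ncard

/-- One step along an edge of the edge set `F`. -/
def Step (ends : E → Sym2 V) (F : Set E) (a b : V) : Prop := ∃ e ∈ F, ends e = s(a, b)

/-- `a` and `b` are joined by a walk using only edges in `F`. -/
def Reaches (ends : E → Sym2 V) (F : Set E) (a b : V) : Prop :=
  Relation.ReflTransGen (Step ends F) a b

/-- The vertex set `S` is connected in the subgraph with edge set `F`. -/
def ConnectsSet (ends : E → Sym2 V) (F : Set E) (S : Set V) : Prop :=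
  ∀ a ∈ S, ∀ b ∈ S, Reaches ends F a b

/-- A walk from `u` to `w` given by a list of edges. -/
inductive IsWalk (ends : E → Sym2 V) : V → V → List E → Prop
  | nil (v : V) : IsWalk ends v v []
  | cons {u v w : V} {e : E} {l : List E} :
      ends e = s(u, v) → IsWalk ends v w l → IsWalk ends u w (e :: l)

/-- A path from `u` to `v` using edges of `F` (a walk with no repeated edges). -/
def IsPathIn (ends : E → Sym2 V) (F : Set E) (u v : V) (l : List E) : Prop :=
  IsWalk ends u v l ∧ l.Nodup ∧ ∀ e ∈ l, e ∈ F

/-- There are `n` pairwise edge-disjoint paths from `u` to `v` inside `F`. -/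
def EdgeDisjointPathsIn (ends : E → Sym2 V) (F : Set E) (n : ℕ) (u v : V) : Prop :=
  ∃ P : Fin n → List E, (∀ i, IsPathIn ends F u v (P i)) ∧
    ∀ i j, i ≠ j → ∀ e ∈ P i, e ∉ P j

/-- `S` is `n`-edge-connected in the (sub)graph with edge set `F`:
any two distinct vertices of `S` are joined by `n` edge-disjoint paths. -/
def EdgeConnectedIn (ends : E → Sym2 V) (F : Set E) (S : Set V) (n : ℕ) : Prop :=
  ∀ a ∈ S, ∀ b ∈ S, a ≠ b → EdgeDisjointPathsIn ends F n a b

/-- A family of subgraphs (edge sets) is pairwise edge-disjoint. -/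
def PairwiseEdgeDisjoint {k : ℕ} (H : Fin k → Set E) : Prop :=
  ∀ i j, i ≠ j → Disjoint (H i) (H j)

/-- `v` is a cut vertex of the subgraph with edge set `H`: some two vertices
distinct from `v` are connected in `H` but not after removing `v`. -/
def IsCutVertexOf (ends : E → Sym2 V) (H : Set E) (v : V) : Prop :=
  ∃ a b : V, a ≠ v ∧ b ≠ v ∧ Reaches ends H a b ∧
    ¬ Reaches ends {e ∈ H | v ∉ ends e} a b

/-- A subpartition of `E(v)` into `k` (possibly empty) parts. -/
def IsSubpartitionAt {k : ℕ} (ends : E → Sym2 V) (v : V) (P : Fin k → Set E) : Prop :=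
  (∀ i, P i ⊆ incEdges ends v) ∧ ∀ i j, i ≠ j → Disjoint (P i) (P j)

/-- A balanced partition of `E(v)` into `k` parts: each part has ≥ 2 edges. -/
def IsBalancedPartitionAt {k : ℕ} (ends : E → Sym2 V) (v : V) (P : Fin k → Set E) : Prop :=
  IsSubpartitionAt ends v P ∧ (⋃ i, P i) = incEdges ends v ∧ ∀ i, 2 ≤ (P i).ncard

/-- A balanced subpartition of `E(v)`: one extendable to a balanced partition. -/
def IsBalancedSubpartitionAt {k : ℕ} (ends : E → Sym2 V) (v : V) (P : Fin k → Set E) : Prop :=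
  IsSubpartitionAt ends v P ∧
    ∃ P' : Fin k → Set E, IsBalancedPartitionAt ends v P' ∧ ∀ i, P i ⊆ P' i

/-- The subgraphs `H 1, …, H k` extend the subpartition `P` at `v`:
`P i ⊆ H i` and `v` is not a cut vertex of any `H i`. -/
def Extend {k : ℕ} (ends : E → Sym2 V) (v : V) (P H : Fin k → Set E) : Prop :=
  ∀ i, P i ⊆ H i ∧ ¬ IsCutVertexOf ends (H i) v

/-- The subgraphs `H 1, …, H k` balance the vertex `u`. -/
def BalanceVertex {k : ℕ} (ends : E → Sym2 V) (H : Fin k → Set E) (u : V) : Prop :=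
  IsBalancedSubpartitionAt ends u (fun i => incEdges ends u ∩ H i)

/-- The subgraphs `H 1, …, H k` balance every vertex of `T`. -/
def BalanceSet {k : ℕ} (ends : E → Sym2 V) (H : Fin k → Set E) (T : Set V) : Prop :=
  ∀ u ∈ T, BalanceVertex ends H u

/-- A loopless multigraph. -/
def Loopless (ends : E → Sym2 V) : Prop := ∀ e : E, ¬ (ends e).IsDiag

/-- The set of neighbors of a vertex. -/
def neighbors (ends : E → Sym2 V) (u : V) : Set V := {w | ∃ e, ends e = s(u, w)}

open Finset in
open scoped Classical in
/-- A Rado-type selection theorem in a lattice. -/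
theorem exists_selection_sup_eq_top {L O I : Type*} [Lattice L] [OrderTop L] [Fintype I]
    (ρ : L → ℕ) (hρ : ∀ P Q, ρ P + ρ Q ≤ ρ (P ⊓ Q) + ρ (P ⊔ Q)) (h0 : ∀ P, ρ P = 0 → P = ⊤)
    (ev : I → O → L) (A : I → Finset O)
    (hA : ∀ P, ρ P ≤ #{x | ∃ o ∈ A x, ¬ ev x o ≤ P}) :
    ∃ f : I → Option O, (∀ x o, f x = some o → o ∈ A x) ∧
      ∀ P, (∀ x o, f x = some o → ev x o ≤ P) → P = ⊤ := by
  induction hn : ∑ x, #(A x) using Nat.strong_induction_on generalizing A with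
  | _ n ih =>
  by_cases hbig : ∃ x, ∃ o₁ ∈ A x, ∃ o₂ ∈ A x, o₁ ≠ o₂
  · obtain ⟨x, o₁, h₁, o₂, h₂, hne⟩ := hbig
    have key : ∀ o ∈ A x,
        (∀ P, ρ P ≤ #{y | ∃ q ∈ Function.update A x ((A x).erase o) y, ¬ ev y q ≤ P}) →
        ∃ f : I → Option O, (∀ x o, f x = some o → o ∈ A x) ∧
          ∀ P, (∀ x o, f x = some o → ev x o ≤ P) → P = ⊤ := by
      intro o ho hP
      have hsub : ∀ y, Function.update A x ((A x).erase o) y ⊆ A y := by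
        intro y
        by_cases hy : y = x
        · subst hy; simpa using erase_subset _ _
        · simp [hy]
      obtain ⟨f, hf, hf'⟩ := ih (∑ y, #(Function.update A x ((A x).erase o) y))
        (by
          rw [← hn]
          refine sum_lt_sum (fun y _ => card_le_card (hsub y)) ⟨x, mem_univ _, ?_⟩
          simpa using card_erase_lt_of_mem ho) _ hP rfl
      exact ⟨f, fun y q hq => hsub y (hf y q hq), hf'⟩
    by_contra hcon
    have viol : ∀ o ∈ A x, ∃ P, #{y | ∃ q ∈ A y, ¬ ev y q ≤ P} ≤ ρ P ∧ ¬ ev x o ≤ P ∧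
        ∀ q ∈ A x, q ≠ o → ev x q ≤ P := by
      intro o ho
      by_contra hno
      apply hcon
      apply key o ho
      intro P
      by_contra hlt
      push Not at hlt
      apply hno
      have hx : ¬ ∃ q ∈ Function.update A x ((A x).erase o) x, ¬ ev x q ≤ P := by
        rintro hq
        refine absurd (hA P) (not_le.2 (lt_of_le_of_lt (card_le_card ?_) hlt))
        intro y hy
        simp only [mem_filter, mem_univ, true_and] at hy ⊢
        by_cases hyx : y = x
        · subst hyx; exact hq
        · simpa [hyx] using hy
      have hins : (univ.filter fun y => ∃ q ∈ A y, ¬ ev y q ≤ P) ⊆ insert x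
          (univ.filter fun y => ∃ q ∈ Function.update A x ((A x).erase o) y, ¬ ev y q ≤ P) := by
        intro y hy
        simp only [mem_insert, mem_filter, mem_univ, true_and] at hy ⊢
        by_cases hyx : y = x
        · exact Or.inl hyx
        · right; simpa [hyx] using hy
      have hcard := (card_le_card hins).trans (card_insert_le _ _)
      have hall : ∀ q ∈ A x, q ≠ o → ev x q ≤ P := by
        intro q hq hqo
        by_contra hc
        exact hx ⟨q, by simpa using ⟨hqo, hq⟩, hc⟩
      refine ⟨P, by omega, ?_, hall⟩
      intro hle
      refine absurd (hA P) (not_le.2 (lt_of_le_of_lt (card_le_card ?_) hlt))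
      intro y hy
      simp only [mem_filter, mem_univ, true_and] at hy ⊢
      by_cases hyx : y = x
      · subst hyx
        obtain ⟨q, hq, hqP⟩ := hy
        by_cases hqo : q = o
        · exact absurd (hqo ▸ hle) hqP
        · exact absurd (hall q hq hqo) hqP
      · simpa [hyx] using hy
    obtain ⟨P, hP, hP₁, hP₂⟩ := viol o₁ h₁
    obtain ⟨Q, hQ, hQ₁, hQ₂⟩ := viol o₂ h₂
    have hx : x ∉ (univ.filter fun y => ∃ q ∈ A y, ¬ ev y q ≤ P ⊔ Q) := by
      simp only [mem_filter, mem_univ, true_and, not_exists, not_and, not_not]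
      intro q hq
      by_cases hq1 : q = o₁
      · exact (hQ₂ q hq (hq1 ▸ hne)).trans le_sup_right
      · exact (hP₂ q hq hq1).trans le_sup_left
    have hsup : insert x (univ.filter fun y => ∃ q ∈ A y, ¬ ev y q ≤ P ⊔ Q) ⊆
        (univ.filter fun y => ∃ q ∈ A y, ¬ ev y q ≤ P) ∩
          (univ.filter fun y => ∃ q ∈ A y, ¬ ev y q ≤ Q) := by
      intro y hy
      simp only [mem_insert, mem_inter, mem_filter, mem_univ, true_and] at hy ⊢
      rcases hy with rfl | ⟨q, hq, hqP⟩
      · exact ⟨⟨o₁, h₁, hP₁⟩, ⟨o₂, h₂, hQ₁⟩⟩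
      · exact ⟨⟨q, hq, fun h => hqP (h.trans le_sup_left)⟩,
          ⟨q, hq, fun h => hqP (h.trans le_sup_right)⟩⟩
    have hinf : (univ.filter fun y => ∃ q ∈ A y, ¬ ev y q ≤ P ⊓ Q) ⊆
        (univ.filter fun y => ∃ q ∈ A y, ¬ ev y q ≤ P) ∪
          (univ.filter fun y => ∃ q ∈ A y, ¬ ev y q ≤ Q) := by
      intro y hy
      simp only [mem_union, mem_filter, mem_univ, true_and] at hy ⊢
      obtain ⟨q, hq, hqP⟩ := hy
      by_cases h : ev y q ≤ P
      · exact Or.inr ⟨q, hq, fun h' => hqP (le_inf h h')⟩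
      · exact Or.inl ⟨q, hq, h⟩
    have c1 := card_le_card hsup
    rw [card_insert_of_notMem hx] at c1
    have c2 := card_le_card hinf
    have c3 := card_union_add_card_inter (univ.filter fun y => ∃ q ∈ A y, ¬ ev y q ≤ P)
          (univ.filter fun y => ∃ q ∈ A y, ¬ ev y q ≤ Q)
    have c4 := hρ P Q
    have c5 := hA (P ⊓ Q)
    have c6 := hA (P ⊔ Q)
    omega
  · push Not at hbig
    refine ⟨fun x => if h : (A x).Nonempty then some h.choose else none, ?_, ?_⟩
    · intro x o ho
      by_cases h : (A x).Nonempty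
      · simp only [h, dif_pos, Option.some.injEq] at ho
        exact ho ▸ h.choose_spec
      · simp [h] at ho
    · intro P hP
      apply h0
      refine Nat.le_zero.1 ((hA P).trans (le_of_eq ?_))
      rw [card_eq_zero, filter_eq_empty_iff]
      rintro x - ⟨o, ho, hoP⟩
      have hne : (A x).Nonempty := ⟨o, ho⟩
      exact hoP (hP x o (by simp [hne, hbig x _ hne.choose_spec o ho]))

/-- The functions that are constant on the classes of a setoid. -/
def constOn {T : Type*} (P : Setoid T) : Submodule ℚ (T → ℚ) where
  carrier := {f | ∀ a b, P a b → f a = f b}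
  add_mem' := fun hf hg a b h => by simp [hf a b h, hg a b h]
  zero_mem' := fun _ _ _ => rfl
  smul_mem' := fun c f hf a b h => by simp [hf a b h]

theorem finrank_constOn {T : Type*} [Finite T] (P : Setoid T) :
    Module.finrank ℚ (constOn P) = Nat.card (Quotient P) := by
  have := Fintype.ofFinite (Quotient P)
  let φ : constOn P ≃ₗ[ℚ] (Quotient P → ℚ) :=
    { toFun := fun f => Quotient.lift f.1 f.2
      map_add' := fun f g => by ext q; induction q using Quotient.ind; rfl
      map_smul' := fun c f => by ext q; induction q using Quotient.ind; rfl
      invFun := fun g => ⟨fun a => g (Quotient.mk P a), fun a b h =>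
        congrArg g (Quotient.sound (s := P) h)⟩
      left_inv := fun f => rfl
      right_inv := fun g => by ext q; induction q using Quotient.ind; rfl }
  rw [φ.finrank_eq, Module.finrank_fintype_fun_eq_card, Nat.card_eq_fintype_card]

theorem card_quotient_supermodular {T : Type*} [Finite T] (P Q : Setoid T) :
    Nat.card (Quotient P) + Nat.card (Quotient Q) ≤
      Nat.card (Quotient (P ⊓ Q)) + Nat.card (Quotient (P ⊔ Q)) := by
  simp only [← finrank_constOn]
  have h1 : constOn P ⊓ constOn Q ≤ constOn (P ⊔ Q) := by
    rintro f ⟨hf, hg⟩ a b hab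
    have : P ⊔ Q ≤ Setoid.ker f := sup_le (fun {x y} h => hf x y h) (fun {x y} h => hg x y h)
    exact this hab
  have h2 : constOn P ⊔ constOn Q ≤ constOn (P ⊓ Q) :=
    sup_le (fun f hf a b h => hf a b h.1) (fun f hf a b h => hf a b h.2)
  rw [← Submodule.finrank_sup_add_finrank_inf_eq]
  exact add_le_add (Submodule.finrank_mono h2) (Submodule.finrank_mono h1)

theorem card_quotient_mono {T : Type*} [Finite T] {P Q : Setoid T} (h : P ≤ Q) :
    Nat.card (Quotient Q) ≤ Nat.card (Quotient P) :=
  Nat.card_le_card_of_surjective (Quotient.map' id h)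
    (fun q => Quotient.inductionOn' q fun a => ⟨Quotient.mk'' a, rfl⟩)

theorem card_quotient_strict {T : Type*} [Finite T] {P Q : Setoid T} (h : P ≤ Q) {a b : T}
    (hQ : Q a b) (hP : ¬ P a b) : Nat.card (Quotient Q) + 1 ≤ Nat.card (Quotient P) := by
  simp only [← finrank_constOn]
  refine Submodule.finrank_lt_finrank_of_lt
    (lt_of_le_not_ge (fun f hf x y hxy => hf x y (h hxy)) ?_)
  classical
  intro hle
  have := hle (x := fun x => if P a x then 1 else 0) (by
    intro x y hxy
    have : P a x ↔ P a y := ⟨fun h => P.trans' h hxy, fun h => P.trans' h (P.symm' hxy)⟩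
    simp [this]) a b hQ
  simp [hP] at this

theorem eq_top_of_card_quotient_le_one {T : Type*} [Finite T] {P : Setoid T}
    (h : Nat.card (Quotient P) ≤ 1) : P = ⊤ := by
  by_contra hP
  have : ∃ a b, ¬ P a b := by
    by_contra hc
    push Not at hc
    exact hP (top_le_iff.1 fun {a b} _ => hc a b)
  obtain ⟨a, b, hab⟩ := this
  have h1 := card_quotient_strict (le_top : P ≤ ⊤) (a := a) (b := b) trivial hab
  have : Nonempty (Quotient (⊤ : Setoid T)) := ⟨Quotient.mk _ a⟩
  have h2 : 0 < Nat.card (Quotient (⊤ : Setoid T)) := Nat.card_pos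
  omega

open Finset in
open scoped Classical in
/-- Summing the cut condition of a hypergraph with marked hyperedges over the classes of a
partition. -/
theorem sum_cut_le {T I : Type*} [Fintype T] [Fintype I] (h : I → Finset T) (mk : I → Prop) (N : ℕ)
    (hcard : ∀ x, ¬ mk x → #(h x) ≤ 3) (hcard' : ∀ x, mk x → #(h x) ≤ 2)
    (hcut : ∀ Y : Finset T, Y.Nonempty →
      N ≤ #{x | (∃ a ∈ h x, a ∈ Y) ∧ (mk x ∨ ∃ b ∈ h x, b ∉ Y)}) (P : Setoid T) :
    N * Nat.card (Quotient P) ≤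
      min 3 (Nat.card (Quotient P)) * #{x | ¬ mk x ∧ ∃ a ∈ h x, ∃ b ∈ h x, ¬ P a b} +
        #{x | mk x} + #{x | mk x ∧ ∃ a ∈ h x, ∃ b ∈ h x, ¬ P a b} := by
  set X : I → Prop := fun x => ∃ a ∈ h x, ∃ b ∈ h x, ¬ P a b with hX
  let q : T → Quotient P := Quotient.mk P
  let cls : Quotient P → Finset T := fun c => univ.filter fun a => q a = c
  let inc : Quotient P → I → Prop := fun c x =>
    (∃ a ∈ h x, a ∈ cls c) ∧ (mk x ∨ ∃ b ∈ h x, b ∉ cls c)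
  have hcls : ∀ c, (cls c).Nonempty := fun c => by
    induction c using Quotient.ind with
    | _ a => exact ⟨a, by simp [cls, q]⟩
  have hsum : N * Nat.card (Quotient P) ≤ ∑ c : Quotient P, #{x | inc c x} := by
    rw [Nat.card_eq_fintype_card, mul_comm, ← smul_eq_mul, ← card_univ]
    exact card_nsmul_le_sum _ _ _ fun c _ => hcut (cls c) (hcls c)
  have hswap : ∑ c : Quotient P, #{x | inc c x} = ∑ x, #{c | inc c x} :=
    sum_card_bipartiteAbove_eq_sum_card_bipartiteBelow inc
  have himg : ∀ x, #{c | inc c x} ≤ #((h x).image q) := fun x => by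
    apply card_le_card
    intro c hc
    simp only [mem_filter, mem_univ, true_and, inc, cls] at hc
    obtain ⟨⟨a, ha, hac⟩, -⟩ := hc
    exact mem_image.2 ⟨a, ha, hac⟩
  have hnoX : ∀ x, ¬ X x → #((h x).image q) ≤ 1 := fun x hx => by
    rw [card_le_one]
    intro c hc d hd
    obtain ⟨a, ha, rfl⟩ := mem_image.1 hc
    obtain ⟨b, hb, rfl⟩ := mem_image.1 hd
    by_contra hab
    exact hx ⟨a, ha, b, hb, fun hP => hab (Quotient.sound hP)⟩
  have hpt : ∀ x, #{c | inc c x} ≤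
      min 3 (Nat.card (Quotient P)) * (if ¬ mk x ∧ X x then 1 else 0) +
        (if mk x then 1 else 0) + (if mk x ∧ X x then 1 else 0) := by
    intro x
    have h1 := himg x
    have h2 : #((h x).image q) ≤ #(h x) := card_image_le
    have h3 : #((h x).image q) ≤ Nat.card (Quotient P) := by
      rw [Nat.card_eq_fintype_card]; exact card_le_univ _
    by_cases hm : mk x
    · have := hcard' x hm
      by_cases hx : X x
      · simp only [hm, hx, not_true, false_and, if_false, if_true, and_self]; omega
      · have := hnoX x hx
        simp only [hm, hx, not_true, if_false, if_true, and_false]; omega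
    · have := hcard x hm
      by_cases hx : X x
      · simp only [hm, hx, not_false_eq_true, if_false, if_true, and_self, add_zero, false_and]
        rw [mul_one]
        exact (le_min (h1.trans (h2.trans this)) (h1.trans h3))
      · simp only [hm, hx, not_false_eq_true, and_false, if_false]
        simp only [mul_zero, add_zero]
        rw [Nat.le_zero, card_eq_zero, filter_eq_empty_iff]
        rintro c - ⟨⟨a, ha, hac⟩, hb⟩
        obtain ⟨b, hb, hbc⟩ := hb.resolve_left hm
        apply hx
        refine ⟨a, ha, b, hb, fun hP => hbc ?_⟩
        simp only [mem_filter, mem_univ, true_and, cls] at hac ⊢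
        rw [← hac]
        exact (Quotient.sound hP).symm
  refine hsum.trans ((hswap.le.trans (sum_le_sum fun x _ => hpt x)).trans (le_of_eq ?_))
  rw [sum_add_distrib, sum_add_distrib, ← mul_sum]
  simp only [card_filter, hX]

/-- The arithmetic behind the packing count for a hypergraph. -/
theorem packing_arith {k N t e G W γ u M R D : ℕ} (hN : 7 * k ≤ N) (ht : 1 ≤ t)
    (h1 : N * t ≤ min 3 t * e + N + (G + W)) (h2 : R + γ ≤ k * (t - 1)) (h3 : M ≤ k * u)
    (h4 : u ≤ t) (h5 : 0 < W → u + 2 ≤ t) (h6 : W + 2 * k ≤ N + 2 * γ) (h6' : W = 0 → γ = 0)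
    (h7 : t = 3 → u = 3 → M ≤ 2 * k + D ∧ 2 * D ≤ G) (h8 : t = 1 → M = 0) :
    R + M ≤ e + G := by
  obtain rfl | rfl | rfl | ht4 : t = 1 ∨ t = 2 ∨ t = 3 ∨ 4 ≤ t := by omega
  · have := h8 rfl
    omega
  · simp only [show min 3 2 = 2 from rfl] at h1
    rcases Nat.eq_zero_or_pos W with hW | hW
    · have : k * u ≤ k * 2 := Nat.mul_le_mul_left _ h4
      omega
    · have hu : u = 0 := by have := h5 hW; omega
      subst hu
      omega
  · simp only [show min 3 3 = 3 from rfl] at h1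
    rcases Nat.eq_zero_or_pos W with hW | hW
    · by_cases hu : u = 3
      · have := h7 rfl hu
        have := h6' hW
        omega
      · have : k * u ≤ k * 2 := Nat.mul_le_mul_left _ (by omega)
        omega
    · have : k * u ≤ k * 1 := Nat.mul_le_mul_left _ (by have := h5 hW; omega)
      omega
  · obtain ⟨r, rfl⟩ : ∃ r, t = r + 4 := ⟨t - 4, by omega⟩
    have hmin : min 3 (r + 4) = 3 := by omega
    rw [hmin] at h1
    have hr : 7 * k * r ≤ N * r := Nat.mul_le_mul_right _ hN
    have e1 : N * (r + 4) = N * r + 4 * N := by ring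
    have e2 : k * (r + 4 - 1) = k * r + 3 * k := by
      rw [show r + 4 - 1 = r + 3 by omega]; ring
    have e3 : 7 * k * r = 7 * (k * r) := by ring
    rw [e1] at h1
    rw [e2] at h2
    rw [e3] at hr
    rcases Nat.eq_zero_or_pos W with hW | hW
    · have : k * u ≤ k * (r + 4) := Nat.mul_le_mul_left _ h4
      have e4 : k * (r + 4) = k * r + 4 * k := by ring
      have := h6' hW
      omega
    · have : k * u ≤ k * (r + 2) := Nat.mul_le_mul_left _ (by have := h5 hW; omega)
      have e4 : k * (r + 2) = k * r + 2 * k := by ring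
      omega

open Finset in
open scoped Classical in
theorem card_le_card_quotient {T : Type*} [Fintype T] (P : Setoid T) (A : Finset T)
    (hA : ∀ a ∈ A, ∀ b ∈ A, P a b → a = b) : #A ≤ Nat.card (Quotient P) := by
  rw [Nat.card_eq_fintype_card, ← card_univ]
  refine card_le_card_of_injOn (Quotient.mk P) (fun _ _ => mem_univ _) fun a ha b hb hab => ?_
  exact hA a ha b hb (Quotient.exact hab)

open Finset in
open scoped Classical in
theorem card_filter_ne_none {I C : Type*} [Fintype I] [Fintype C] (κ : I → Option C)
    (p : I → Prop) :
    #{x | κ x ≠ none ∧ p x} = ∑ i, #{x | κ x = some i ∧ p x} := by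
  simp only [card_filter]
  rw [sum_comm]
  refine sum_congr rfl fun x _ => ?_
  cases hx : κ x with
  | none => simp
  | some j => by_cases hp : p x <;> simp [hp]

open Finset in
open scoped Classical in
theorem hypergraph_count {T I : Type*} [Fintype T] [Nonempty T] [Fintype I] {k N : ℕ}
    (hN : 7 * k ≤ N) (h : I → Finset T) (κ : I → Option (Fin k))
    (hn : ∀ x, κ x = none → #(h x) ≤ 3) (hs : ∀ x, κ x ≠ none → 1 ≤ #(h x) ∧ #(h x) ≤ 2)
    (hcut : ∀ Y : Finset T, Y.Nonempty →
      N ≤ #{x | (∃ a ∈ h x, a ∈ Y) ∧ (κ x ≠ none ∨ ∃ b ∈ h x, b ∉ Y)})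
    (hdeg : #{x | κ x ≠ none} = N) (htwo : ∀ i, 2 ≤ #{x | κ x = some i})
    (P : Fin k → Setoid T) (M : Finset (T × Fin k))
    (hM : ∀ τ ∈ M, ∀ x, κ x = some τ.2 → h x ≠ {τ.1}) :
    ∑ i, (Nat.card (Quotient (P i)) - 1) + #M ≤
      #{x | ∃ a ∈ h x, ∃ b ∈ h x, a ≠ b ∧ ((∃ u ∈ h x, ∃ i, (u, i) ∈ M) ∨
        ∃ i, (κ x = none ∨ κ x = some i) ∧ ∃ a ∈ h x, ∃ b ∈ h x, ¬ P i a b)} := by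
  set U : Finset T := univ.filter fun u => ∃ i, (u, i) ∈ M with hU
  have memU : ∀ u, u ∈ U ↔ ∃ i, (u, i) ∈ M := by simp [hU]
  let P' : Setoid T :=
    { r := fun a b => a = b ∨ (a ∉ U ∧ b ∉ U ∧ ∀ i, P i a b)
      iseqv :=
        { refl := fun a => Or.inl rfl
          symm := by
            rintro a b (rfl | ⟨h1, h2, h3⟩)
            · exact Or.inl rfl
            · exact Or.inr ⟨h2, h1, fun i => (P i).symm' (h3 i)⟩
          trans := by
            rintro a b c (rfl | ⟨h1, h2, h3⟩) (rfl | ⟨h4, h5, h6⟩)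
            · exact Or.inl rfl
            · exact Or.inr ⟨h4, h5, h6⟩
            · exact Or.inr ⟨h1, h2, h3⟩
            · exact Or.inr ⟨h1, h5, fun i => (P i).trans' (h3 i) (h6 i)⟩ } }
  have hP' : ∀ a b, P' a b ↔ a = b ∨ (a ∉ U ∧ b ∉ U ∧ ∀ i, P i a b) := fun a b => Iff.rfl
  set t := Nat.card (Quotient P') with ht
  let X : I → Prop := fun x => ∃ a ∈ h x, ∃ b ∈ h x, ¬ P' a b
  let cnt : I → Prop := fun x => (∃ u ∈ h x, u ∈ U) ∨
    ∃ i, κ x = some i ∧ ∃ a ∈ h x, ∃ b ∈ h x, ¬ P i a b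
  let γ : Finset (Fin k) := univ.filter fun i => ∃ x, κ x = some i ∧ X x ∧ ¬ cnt x
  let D : Finset (Fin k) := univ.filter fun i => ∀ x, κ x = some i → #(h x) ≠ 1
  have hU1 : ∀ u ∈ U, ∀ b, P' u b → u = b := by
    rintro u hu b (hb | ⟨h1, -⟩)
    · exact hb
    · exact absurd hu h1
  have hU2 : ∀ u ∈ U, ∀ b, P' b u → b = u := fun u hu b hb => (hU1 u hu b (P'.symm' hb)).symm
  have (Q : Setoid T) : Nonempty (Quotient Q) := Nonempty.map (Quotient.mk Q) inferInstance
  have key := packing_arith (k := k) (N := N) (t := t)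
    (e := #{x | ¬ κ x ≠ none ∧ X x}) (G := #{x | κ x ≠ none ∧ X x ∧ cnt x})
    (W := #{x | κ x ≠ none ∧ X x ∧ ¬ cnt x}) (γ := #γ) (u := #U) (M := #M)
    (R := ∑ i, (Nat.card (Quotient (P i)) - 1)) (D := #D) hN
    Nat.card_pos ?h1 ?h2 ?h3 ?h4 ?h5 ?h6 ?h6' ?h7 ?h8
  case h1 =>
    have : N * t ≤ min 3 t * #{x | ¬ κ x ≠ none ∧ X x} + #{x | κ x ≠ none} +
        #{x | κ x ≠ none ∧ X x} := by
      convert sum_cut_le h (fun x => κ x ≠ none) N (fun x hx => hn x (not_not.1 hx))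
        (fun x hx => (hs x hx).2) (fun Y hY => by convert hcut Y hY) P'
    rw [hdeg] at this
    refine this.trans (Nat.add_le_add_left (le_of_eq ?_) _)
    rw [← card_union_of_disjoint, ← filter_or]
    · congr 1
      ext x
      simp only [mem_filter, mem_univ, true_and]
      by_cases hc : cnt x <;> simp [hc]
    · rw [disjoint_filter]
      exact fun x _ h1 h2 => h2.2.2 h1.2.2
  case h2 =>
    have : #γ = ∑ i, if i ∈ γ then 1 else 0 := by simp
    rw [this, ← sum_add_distrib]
    refine (sum_le_card_nsmul _ _ (t - 1) fun i _ => ?_).trans (by simp)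
    have hle : P' ≤ P i := by
      rintro a b (rfl | ⟨-, -, h3⟩)
      · exact (P i).refl' a
      · exact h3 i
    have h1 := card_quotient_mono hle
    have hpos : 0 < Nat.card (Quotient (P i)) := Nat.card_pos
    split_ifs with hi
    · simp only [γ, mem_filter, mem_univ, true_and] at hi
      obtain ⟨x, hx, ⟨a, ha, b, hb, hab⟩, hc⟩ := hi
      have hPi : P i a b := by
        by_contra hP
        exact hc (Or.inr ⟨i, hx, a, ha, b, hb, hP⟩)
      have := card_quotient_strict hle hPi hab
      omega
    · omega
  case h3 =>
    have : M ⊆ U ×ˢ univ := fun τ hτ => by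
      simp only [mem_product, mem_univ, and_true, memU]
      exact ⟨τ.2, hτ⟩
    refine (card_le_card this).trans ?_
    simp [mul_comm]
  case h4 => exact card_le_card_quotient P' U fun a ha b _ hab => hU1 a ha b hab
  case h5 =>
    intro hW
    obtain ⟨x, hx⟩ := card_pos.1 hW
    simp only [mem_filter, mem_univ, true_and] at hx
    obtain ⟨-, ⟨a, ha, b, hb, hab⟩, hc⟩ := hx
    have ha' : a ∉ U := fun hu => hc (Or.inl ⟨a, ha, hu⟩)
    have hb' : b ∉ U := fun hu => hc (Or.inl ⟨b, hb, hu⟩)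
    have hne : a ≠ b := fun he => hab (Or.inl he)
    have := card_le_card_quotient P' (insert a (insert b U)) (by
      intro c hc d hd hcd
      by_cases hcU : c ∈ U
      · exact hU1 c hcU d hcd
      by_cases hdU : d ∈ U
      · exact hU2 d hdU c hcd
      simp only [mem_insert, hcU, hdU, or_false] at hc hd
      rcases hc with rfl | rfl <;> rcases hd with rfl | rfl
      · rfl
      · exact absurd hcd hab
      · exact absurd (P'.symm' hcd) hab
      · rfl)
    rwa [card_insert_of_notMem (by simp [hne, ha']), card_insert_of_notMem hb'] at this
  case h6 =>
    have e1 : #{x | κ x ≠ none ∧ X x ∧ ¬ cnt x} = ∑ i, #{x | κ x = some i ∧ X x ∧ ¬ cnt x} := by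
      convert card_filter_ne_none κ (fun x => X x ∧ ¬ cnt x)
    have e2 : N = ∑ i, #{x | κ x = some i} := by
      rw [← hdeg]
      simpa using card_filter_ne_none κ (fun x => True)
    have e3 : #γ = ∑ i, if i ∈ γ then 1 else 0 := by simp
    have e4 : 2 * k = ∑ i : Fin k, 2 := by simp [mul_comm]
    rw [e1, e2, e3, e4, mul_sum, ← sum_add_distrib, ← sum_add_distrib]
    refine sum_le_sum fun i _ => ?_
    split_ifs with hi
    · refine Nat.add_le_add (card_le_card fun x => ?_) le_rfl
      simp +contextual
    · have : #{x | κ x = some i ∧ X x ∧ ¬ cnt x} = 0 := by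
        rw [card_eq_zero, filter_eq_empty_iff]
        intro x _ hx
        exact hi (by simpa [γ] using ⟨x, hx⟩)
      have := htwo i
      omega
  case h6' =>
    intro hW
    rw [card_eq_zero, filter_eq_empty_iff] at hW ⊢
    rintro i - ⟨x, hx⟩
    exact hW (mem_univ x) ⟨by simp [hx.1], hx.2⟩
  case h7 =>
    intro ht3 hu3
    have hUu : ∀ a, a ∈ U := by
      intro a
      by_contra ha
      have := card_le_card_quotient P' (insert a U) (by
        intro c hc d hd hcd
        by_cases hcU : c ∈ U
        · exact hU1 c hcU d hcd
        by_cases hdU : d ∈ U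
        · exact hU2 d hdU c hcd
        simp only [mem_insert, hcU, hdU, or_false] at hc hd
        rw [hc, hd])
      rw [card_insert_of_notMem ha] at this
      omega
    constructor
    · have e1 : #M = ∑ i, #{u | (u, i) ∈ M} := by
        rw [card_eq_sum_card_fiberwise (f := Prod.snd) (t := univ) (fun _ _ => mem_univ _)]
        refine sum_congr rfl fun i _ => ?_
        refine card_bij' (fun τ _ => τ.1) (fun u _ => (u, i)) ?_ ?_ ?_ ?_
        · rintro ⟨u, j⟩ hj
          simp only [mem_filter] at hj ⊢
          simpa [← hj.2] using hj.1
        · intro u hu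
          simpa using hu
        · rintro ⟨u, j⟩ hj
          simp only [mem_filter] at hj
          simp [hj.2]
        · intro u hu
          rfl
      have e3 : #D = ∑ i, if i ∈ D then 1 else 0 := by simp
      have e4 : 2 * k = ∑ i : Fin k, 2 := by simp [mul_comm]
      rw [e1, e3, e4, ← sum_add_distrib]
      refine sum_le_sum fun i _ => ?_
      split_ifs with hi
      · exact (card_le_card fun u _ => hUu u).trans hu3.le
      · simp only [D, mem_filter, mem_univ, true_and, not_forall, not_not] at hi
        obtain ⟨x, hx, hx1⟩ := hi
        obtain ⟨u, hu⟩ := card_eq_one.1 hx1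
        have : #{w | (w, i) ∈ M} < #U := by
          refine card_lt_card ((ssubset_iff_of_subset fun w _ => hUu w).2 ⟨u, hUu u, ?_⟩)
          simp only [mem_filter, mem_univ, true_and]
          exact fun hc => hM _ hc x hx hu
        omega
    · have e1 : #{x | κ x ≠ none ∧ X x ∧ cnt x} = ∑ i, #{x | κ x = some i ∧ X x ∧ cnt x} := by
        convert card_filter_ne_none κ (fun x => X x ∧ cnt x)
      have e3 : #D = ∑ i, if i ∈ D then 1 else 0 := by simp
      rw [e1, e3, mul_sum]
      refine sum_le_sum fun i _ => ?_
      split_ifs with hi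
      · refine (htwo i).trans (card_le_card fun x hx => ?_)
        simp only [mem_filter, mem_univ, true_and, D] at hx hi ⊢
        have h1 := hi x hx
        have h2 := hs x (by simp [hx])
        obtain ⟨a, b, hab, he⟩ := card_eq_two.1 (show #(h x) = 2 by omega)
        have ha : a ∈ h x := by simp [he]
        have hb : b ∈ h x := by simp [he]
        exact ⟨hx, ⟨a, ha, b, hb, fun hP => hab (hU1 a (hUu a) b hP)⟩, Or.inl ⟨a, ha, hUu a⟩⟩
      · simp
  case h8 =>
    intro ht1
    rw [card_eq_zero, eq_empty_iff_forall_notMem]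
    rintro ⟨u, i⟩ hu
    have htop : P' = ⊤ := eq_top_of_card_quotient_le_one ht1.le
    have hall : ∀ b, u = b := fun b => hU1 u ((memU u).2 ⟨i, hu⟩) b (by rw [htop]; trivial)
    obtain ⟨x, hx⟩ := card_pos.1 (lt_of_lt_of_le zero_lt_two (htwo i))
    simp only [mem_filter, mem_univ, true_and] at hx
    obtain ⟨b, hb⟩ := card_pos.1 (hs x (by simp [hx])).1
    refine hM _ hu x hx ?_
    ext c
    rw [← hall c]
    simpa [hall b] using hb
  refine key.trans ?_
  rw [← card_union_of_disjoint, ← filter_or]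
  · refine card_le_card fun x => ?_
    simp only [mem_filter, mem_univ, true_and, not_not]
    rintro (⟨hx, a, ha, b, hb, hab⟩ | ⟨hx, ⟨a, ha, b, hb, hab⟩, hc⟩)
    · rw [hP'] at hab
      push Not at hab
      refine ⟨a, ha, b, hb, hab.1, ?_⟩
      by_cases haU : a ∈ U
      · exact Or.inl ⟨a, ha, (memU a).1 haU⟩
      by_cases hbU : b ∈ U
      · exact Or.inl ⟨b, hb, (memU b).1 hbU⟩
      obtain ⟨i, hi⟩ := hab.2 haU hbU
      exact Or.inr ⟨i, Or.inl hx, a, ha, b, hb, hi⟩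
    · refine ⟨a, ha, b, hb, fun he => hab (Or.inl he), ?_⟩
      rcases hc with ⟨u, hu, huU⟩ | ⟨i, hi, hc⟩
      · exact Or.inl ⟨u, hu, (memU u).1 huU⟩
      · exact Or.inr ⟨i, Or.inr hi, hc⟩
  · rw [disjoint_filter]
    rintro x - ⟨h1, -⟩ ⟨h2, -⟩
    exact h1 h2

/-- The finest equivalence relation in which `A` is contained in one class. -/
def mergeSetoid {T : Type*} (A : Finset T) : Setoid T where
  r a b := a = b ∨ (a ∈ A ∧ b ∈ A)
  iseqv :=
    { refl := fun _ => Or.inl rfl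
      symm := by
        rintro a b (rfl | ⟨h1, h2⟩)
        · exact Or.inl rfl
        · exact Or.inr ⟨h2, h1⟩
      trans := by
        rintro a b c (rfl | ⟨h1, h2⟩) (rfl | ⟨h3, h4⟩)
        · exact Or.inl rfl
        · exact Or.inr ⟨h3, h4⟩
        · exact Or.inr ⟨h1, h2⟩
        · exact Or.inr ⟨h1, h4⟩ }

theorem mergeSetoid_le {T : Type*} {A : Finset T} {P : Setoid T} :
    mergeSetoid A ≤ P ↔ ∀ a ∈ A, ∀ b ∈ A, P a b := by
  constructor
  · exact fun h a ha b hb => h (Or.inr ⟨ha, hb⟩)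
  · rintro h a b (rfl | ⟨ha, hb⟩)
    · exact P.refl' a
    · exact h a ha b hb

open Finset in
open scoped Classical in
/-- Each hyperedge either is merged in one of `k` colours or is used as a token at one of its
vertices, so that every colour connects the vertex set and each vertex gets a token of each
colour (except where a marked singleton already provides it). -/
theorem hypergraph_packing {T I : Type*} [Fintype T] [Nonempty T] [Fintype I] {k N : ℕ}
    (hN : 7 * k ≤ N) (h : I → Finset T) (κ : I → Option (Fin k))
    (hn : ∀ x, κ x = none → #(h x) ≤ 3) (hs : ∀ x, κ x ≠ none → 1 ≤ #(h x) ∧ #(h x) ≤ 2)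
    (hcut : ∀ Y : Finset T, Y.Nonempty →
      N ≤ #{x | (∃ a ∈ h x, a ∈ Y) ∧ (κ x ≠ none ∨ ∃ b ∈ h x, b ∉ Y)})
    (hdeg : #{x | κ x ≠ none} = N) (htwo : ∀ i, 2 ≤ #{x | κ x = some i}) :
    ∃ opt : I → Option (Fin k ⊕ T × Fin k),
      (∀ x i, opt x = some (Sum.inl i) → κ x = none ∨ κ x = some i) ∧
      (∀ x τ, opt x = some (Sum.inr τ) → τ.1 ∈ h x ∧ 2 ≤ #(h x)) ∧
      (∀ i (Y : T → Bool) a b, Y a ≠ Y b → ∃ x, opt x = some (Sum.inl i) ∧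
        ∃ a ∈ h x, ∃ b ∈ h x, Y a ≠ Y b) ∧
      ∀ u i, (∃ x, opt x = some (Sum.inr (u, i))) ∨ ∃ x, κ x = some i ∧ h x = {u} := by
  let tok := {τ : T × Fin k // ∀ x, κ x = some τ.2 → h x ≠ {τ.1}}
  let ρ : (Fin k → Setoid T) × Set tok → ℕ :=
    fun P => ∑ i, (Nat.card (Quotient (P.1 i)) - 1) + (P.2ᶜ).ncard
  let ev : I → Fin k ⊕ tok → (Fin k → Setoid T) × Set tok := fun x o =>
    o.elim (fun i => (Function.update ⊥ i (mergeSetoid (h x)), ∅)) (fun τ => (⊥, {τ}))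
  let A : I → Finset (Fin k ⊕ tok) := fun x => univ.filter fun o =>
    2 ≤ #(h x) ∧ o.elim (fun i => κ x = none ∨ κ x = some i) (fun τ => τ.1.1 ∈ h x)
  have hev1 : ∀ x i P, ev x (Sum.inl i) ≤ P ↔ ∀ a ∈ h x, ∀ b ∈ h x, P.1 i a b := by
    intro x i P
    rw [← mergeSetoid_le]
    constructor
    · intro hle
      simpa [ev] using hle.1 i
    · intro hle
      refine ⟨fun j => ?_, by simp [ev]⟩
      by_cases hj : j = i
      · subst hj
        simpa [ev] using hle
      · simp [ev, hj]
  have hev2 : ∀ x τ P, ev x (Sum.inr τ) ≤ P ↔ τ ∈ P.2 := by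
    intro x τ P
    constructor
    · intro hle
      simpa [ev] using hle.2
    · intro hle
      exact ⟨by simp [ev], by simpa [ev] using hle⟩
  have hpos : ∀ Q : Setoid T, 1 ≤ Nat.card (Quotient Q) := fun Q => by
    have : Nonempty (Quotient Q) := Nonempty.map (Quotient.mk Q) inferInstance
    exact Nat.card_pos
  obtain ⟨f, hf1, hf2⟩ := exists_selection_sup_eq_top ρ
    (by
      rintro ⟨P, S⟩ ⟨Q, S'⟩
      have h1 : ∑ i, (Nat.card (Quotient (P i)) - 1) + ∑ i, (Nat.card (Quotient (Q i)) - 1) ≤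
          ∑ i, (Nat.card (Quotient ((P ⊓ Q) i)) - 1) +
          ∑ i, (Nat.card (Quotient ((P ⊔ Q) i)) - 1) := by
        rw [← sum_add_distrib, ← sum_add_distrib]
        refine sum_le_sum fun i _ => ?_
        have := card_quotient_supermodular (P i) (Q i)
        have := hpos (P i)
        have := hpos (Q i)
        have := hpos (P i ⊓ Q i)
        have := hpos (P i ⊔ Q i)
        simp only [Pi.inf_apply, Pi.sup_apply]
        omega
      have h2 := Set.ncard_union_add_ncard_inter Sᶜ S'ᶜ
      rw [← Set.compl_inter, ← Set.compl_union] at h2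
      change _ + _ + (_ + _) ≤ _ + (S ∩ S')ᶜ.ncard + (_ + (S ∪ S')ᶜ.ncard)
      change _ ≤ ∑ i, (Nat.card (Quotient ((P ⊓ Q) i)) - 1) + _ +
        (∑ i, (Nat.card (Quotient ((P ⊔ Q) i)) - 1) + _)
      change ∑ i, (Nat.card (Quotient (P i)) - 1) + Sᶜ.ncard +
        (∑ i, (Nat.card (Quotient (Q i)) - 1) + S'ᶜ.ncard) ≤ _
      omega)
    (by
      rintro ⟨P, S⟩ h0
      have h1 := (Nat.add_eq_zero_iff.1 h0).1
      have h2 := (Nat.add_eq_zero_iff.1 h0).2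
      rw [sum_eq_zero_iff] at h1
      rw [Set.ncard_eq_zero, Set.compl_empty_iff] at h2
      refine Prod.ext (funext fun i => eq_top_of_card_quotient_le_one ?_) h2
      have : Nat.card (Quotient (P i)) - 1 = 0 := h1 i (mem_univ i)
      change Nat.card (Quotient (P i)) ≤ 1
      omega)
    ev A
    (by
      rintro ⟨P, S⟩
      have key := hypergraph_count hN h κ hn hs (fun Y hY => by convert hcut Y hY)
        (by convert hdeg) (fun i => by convert htwo i) P
        ((Sᶜ).toFinset.map (Function.Embedding.subtype _))
        (by
          intro τ hτ
          obtain ⟨τ', -, rfl⟩ := mem_map.1 hτ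
          exact τ'.2)
      rw [card_map, ← Set.ncard_eq_toFinset_card'] at key
      refine key.trans (card_le_card fun x => ?_)
      simp only [mem_filter, mem_univ, true_and]
      rintro ⟨a, ha, b, hb, hab, hx⟩
      have h2 : 2 ≤ #(h x) := one_lt_card.2 ⟨a, ha, b, hb, hab⟩
      rcases hx with ⟨u, hu, i, hi⟩ | ⟨i, hi, a, ha, b, hb, hab⟩
      · obtain ⟨τ, hτ, hτ'⟩ := mem_map.1 hi
        refine ⟨Sum.inr τ, ?_, fun hle => ?_⟩
        · simp only [A, mem_filter, mem_univ, true_and, Sum.elim_inr]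
          refine ⟨h2, ?_⟩
          rw [show τ.1 = (u, i) from hτ']
          exact hu
        · rw [hev2] at hle
          simp at hτ
          exact hτ hle
      · refine ⟨Sum.inl i, ?_, fun hle => ?_⟩
        · simp only [A, mem_filter, mem_univ, true_and, Sum.elim_inl]
          exact ⟨h2, hi⟩
        · rw [hev1] at hle
          exact hab (hle a ha b hb))
  refine ⟨fun x => (f x).map (Sum.map id Subtype.val), ?_, ?_, ?_, ?_⟩
  · intro x i hx
    simp only [Option.map_eq_some_iff] at hx
    obtain ⟨o, ho, ho'⟩ := hx
    have := hf1 x o ho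
    rcases o with j | τ
    · simp only [Sum.map_inl, id, Sum.inl.injEq] at ho'
      subst ho'
      simp only [A, mem_filter, mem_univ, true_and, Sum.elim_inl] at this
      exact this.2
    · simp at ho'
  · intro x τ hx
    simp only [Option.map_eq_some_iff] at hx
    obtain ⟨o, ho, ho'⟩ := hx
    have := hf1 x o ho
    rcases o with j | τ'
    · simp at ho'
    · simp only [Sum.map_inr, Sum.inr.injEq] at ho'
      subst ho'
      simp only [A, mem_filter, mem_univ, true_and, Sum.elim_inr] at this
      exact ⟨this.2, this.1⟩
  · intro i Y a b hab
    by_contra! hc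
    have htop := hf2 (Function.update ⊤ i (Setoid.ker Y), Set.univ) (by
      intro x o ho
      rcases o with j | τ
      · rw [hev1]
        intro c hc' d hd
        change (Function.update (⊤ : Fin k → Setoid T) i (Setoid.ker Y) j) c d
        by_cases hj : j = i
        · subst hj
          rw [Function.update_self]
          exact hc x (by simp [ho]) c hc' d hd
        · rw [Function.update_of_ne hj]
          trivial
      · rw [hev2]
        trivial)
    have h1 := congrFun (congrArg Prod.fst htop) i
    simp only [Function.update_self] at h1
    have h2 : Setoid.ker Y a b := by
      rw [h1]
      trivial
    exact hab h2
  · intro u i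
    by_contra! hc
    obtain ⟨hc1, hc2⟩ := hc
    have htop := hf2 (⊤, {⟨(u, i), hc2⟩}ᶜ) (by
      intro x o ho
      rcases o with j | τ
      · rw [hev1]
        intros
        trivial
      · rw [hev2]
        rintro (rfl : τ = _)
        exact hc1 x (by simp [ho]))
    have h1 : ({⟨(u, i), hc2⟩}ᶜ : Set tok) = Set.univ := congrArg Prod.snd htop
    have h2 : (⟨(u, i), hc2⟩ : tok) ∈ ({⟨(u, i), hc2⟩}ᶜ : Set tok) := by
      rw [h1]
      trivial
    exact h2 rfl

section Multigraph

variable {V E : Type*}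

/-- The edge `e` of the multigraph `g` crosses the vertex set `Y`. -/
abbrev Cross (g : E → V × V) (Y : V → Bool) (e : E) : Prop := Y (g e).1 ≠ Y (g e).2

/-- The number of edges crossing `Y`. -/
def cutSize [Fintype E] (g : E → V × V) (Y : V → Bool) : ℕ :=
  (Finset.univ.filter fun e => Cross g Y e).card

/-- `Y` separates the set `S`. -/
def Sep (S : Set V) (Y : V → Bool) : Prop := (∃ a ∈ S, Y a = true) ∧ ∃ b ∈ S, Y b = false

/-- Every cut separating `S` has at least `N` edges. -/
def CutConn [Fintype E] (g : E → V × V) (S : Set V) (N : ℕ) : Prop :=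
  ∀ Y, Sep S Y → N ≤ cutSize g Y

open scoped Classical in
/-- The singleton `{v}` as a Boolean function. -/
noncomputable def pt (v : V) : V → Bool := fun u => decide (u = v)

@[simp] theorem pt_eq_true {v u : V} : pt v u = true ↔ u = v := by simp [pt]

@[simp] theorem pt_eq_false {v u : V} : pt v u = false ↔ u ≠ v := by simp [pt]

/-- The image of a multigraph under a map of the vertices. -/
def mapEnds {W : Type*} (f : V → W) (g : E → V × V) : E → W × W :=
  fun e => (f (g e).1, f (g e).2)

theorem cross_mapEnds {W : Type*} (f : V → W) (g : E → V × V) (Y : W → Bool) (e : E) :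
    Cross (mapEnds f g) Y e ↔ Cross g (Y ∘ f) e := Iff.rfl

theorem cutSize_mapEnds [Fintype E] {W : Type*} (f : V → W) (g : E → V × V) (Y : W → Bool) :
    cutSize (mapEnds f g) Y = cutSize g (Y ∘ f) := rfl

theorem cross_not {g : E → V × V} {Y : V → Bool} {e : E} :
    Cross g (fun w => !Y w) e ↔ Cross g Y e := by
  simp [Cross]

theorem cutSize_not [Fintype E] (g : E → V × V) (Y : V → Bool) :
    cutSize g (fun w => !Y w) = cutSize g Y := by
  simp [cutSize, Cross]

theorem Sep.not {S : Set V} {Y : V → Bool} (h : Sep S Y) : Sep S (fun w => !Y w) := by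
  obtain ⟨⟨a, ha, ha'⟩, b, hb, hb'⟩ := h
  exact ⟨⟨b, hb, by simp [hb']⟩, a, ha, by simp [ha']⟩

theorem Sep.of_ne {S : Set V} {Y : V → Bool} {a b : V} (ha : a ∈ S) (hb : b ∈ S)
    (h : Y a ≠ Y b) : Sep S Y := by
  cases hya : Y a
  · exact ⟨⟨b, hb, by cases hyb : Y b <;> simp_all⟩, a, ha, hya⟩
  · exact ⟨⟨a, ha, hya⟩, b, hb, by cases hyb : Y b <;> simp_all⟩

theorem CutConn.mapEnds [Fintype E] {g : E → V × V} {S S' : Set V} {N : ℕ} (hS : CutConn g S N)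
    (f : V → V) (hf : ∀ u ∈ S', f u = u) (hss : S' ⊆ S) :
    CutConn (mapEnds f g) S' N := by
  rintro Y ⟨⟨a, ha, ha'⟩, b, hb, hb'⟩
  rw [cutSize_mapEnds]
  exact hS _ ⟨⟨a, hss ha, by simp [hf a ha, ha']⟩, b, hss hb, by simp [hf b hb, hb']⟩

/-- The number of edges that are not loops. -/
noncomputable def numNonloop (g : E → V × V) : ℕ := {e | (g e).1 ≠ (g e).2}.ncard

theorem numNonloop_lt [Finite E] {g g' : E → V × V} (h : ∀ e, (g e).1 = (g e).2 →
    (g' e).1 = (g' e).2) {e : E} (he : (g e).1 ≠ (g e).2) (he' : (g' e).1 = (g' e).2) :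
    numNonloop g' < numNonloop g :=
  Set.ncard_lt_ncard ((Set.ssubset_iff_of_subset
    (fun x (hx : (g' x).1 ≠ (g' x).2) hx' => hx (h x hx'))).2 ⟨e, he, fun hc => hc he'⟩)

theorem Cross.ne {g : E → V × V} {Y : V → Bool} {e : E} (h : Cross g Y e) :
    (g e).1 ≠ (g e).2 := fun hc => h (by rw [hc])

theorem cross_pt {g : E → V × V} {u : V} {e : E} :
    Cross g (pt u) e ↔ ((g e).1 = u ∧ (g e).2 ≠ u) ∨ ((g e).1 ≠ u ∧ (g e).2 = u) := by
  by_cases h1 : (g e).1 = u <;> by_cases h2 : (g e).2 = u <;> simp [Cross, pt, h1, h2]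

/-- The set that colour `i` has to connect after deleting `v`: the terminals other than `v` and
the far ends of the edges of colour `i` at `v`. -/
def spanTarget {k : ℕ} (g : E → V × V) (S : Set V) (v : V) (c : E → Fin k) (i : Fin k) : Set V :=
  {u | u ≠ v ∧ (u ∈ S ∨ ∃ e, Cross g (pt v) e ∧ Cross g (pt u) e ∧ c e = i)}

/-- The partial colouring `φ` extends the colouring `c` of the edges at `v`, connects `S - v` and
the far ends of the edges at `v` without using `v`, and leaves every colour at every terminal at
least twice. -/
structure IsExtension [Fintype E] {k : ℕ} (g : E → V × V) (S : Set V) (v : V) (c : E → Fin k)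
    (φ : E → Option (Fin k)) : Prop where
  extends_at : ∀ e, Cross g (pt v) e → φ e = some (c e)
  connects : ∀ i Y, Sep (spanTarget g S v c i) Y →
    ∃ e, φ e = some i ∧ ¬ Cross g (pt v) e ∧ Cross g Y e
  two_le : ∀ i, ∀ u ∈ S, u ≠ v → 2 ≤ (Finset.univ.filter fun e => Cross g (pt u) e ∧
    φ e = some i).card

/-- A colouring of the edges at a terminal of degree `N` that can be extended. -/
structure IsColoring [Fintype E] {k : ℕ} (g : E → V × V) (S : Set V) (v : V) (c : E → Fin k)
    (N : ℕ) : Prop where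
  mem : v ∈ S
  exists_ne : ∃ u ∈ S, u ≠ v
  conn : CutConn g S N
  deg : cutSize g (pt v) = N
  two_le : ∀ i, 2 ≤ (Finset.univ.filter fun e => Cross g (pt v) e ∧ c e = i).card

open Finset in
theorem exists_extension_of_tight_cut [Fintype E] {k N : ℕ} (hk : 0 < k) {g : E → V × V}
    {S : Set V} {v : V} {c : E → Fin k} (hc : IsColoring g S v c N)
    (ih : ∀ g' : E → V × V, numNonloop g' < numNonloop g → ∀ (S : Set V) v (c : E → Fin k),
      IsColoring g' S v c N → ∃ φ, IsExtension g' S v c φ)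
    {X : V → Bool} (hXv : X v = false) {a : V} (haS : a ∈ S) (hXa : X a = true)
    (hX : cutSize g X = N) {e₁ e₂ : E} (he₁ : (g e₁).1 ≠ (g e₁).2) (he₂ : (g e₂).1 ≠ (g e₂).2)
    (h₁ : X (g e₁).1 = true ∧ X (g e₁).2 = true) (h₂ : X (g e₂).1 = false ∧ X (g e₂).2 = false) :
    ∃ φ, IsExtension g S v c φ := by
  classical
  have hav : a ≠ v := fun h => by simp [h, hXv] at hXa
  let f1 : V → V := fun w => if X w then a else w
  let f2 : V → V := fun w => if X w then w else v
  let S1 : Set V := {u | u ∈ S ∧ (X u = false ∨ u = a)}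
  let S2 : Set V := {u | (u ∈ S ∧ X u = true) ∨ u = v}
  have f1v : pt v ∘ f1 = pt v := by
    ext w
    by_cases hw : X w <;> by_cases hwv : w = v <;> simp_all [f1, pt]
  have f1a : pt a ∘ f1 = X := by
    ext w
    by_cases hw : X w
    · simp [f1, hw]
    · have : w ≠ a := fun h => hw (h ▸ hXa)
      simp [f1, hw, pt, this]
  have f1u : ∀ u, X u = false → pt u ∘ f1 = pt u := fun u hu => by
    ext w
    by_cases hw : X w
    · have h1 : w ≠ u := fun h => by simp [h, hu] at hw
      have h2 : a ≠ u := fun h => by simp [h, hu] at hXa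
      simp [f1, hw, pt, h1, h2]
    · simp [f1, hw]
  have f2v : pt v ∘ f2 = fun w => !X w := by
    ext w
    by_cases hw : X w
    · have : w ≠ v := fun h => by simp [h, hXv] at hw
      simp [f2, hw, pt, this]
    · simp [f2, hw]
  have f2u : ∀ u, X u = true → pt u ∘ f2 = pt u := fun u hu => by
    ext w
    by_cases hw : X w
    · simp [f2, hw]
    · have h1 : w ≠ u := fun h => hw (h ▸ hu)
      have h2 : v ≠ u := fun h => by simp [← h, hXv] at hu
      simp [f2, hw, pt, h1, h2]
  obtain ⟨φ1, hφ1⟩ := ih (mapEnds f1 g)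
    (numNonloop_lt (fun e he => by simp [mapEnds, he]) he₁ (by simp [mapEnds, f1, h₁])) S1 v c
    { mem := ⟨hc.mem, Or.inl hXv⟩
      exists_ne := ⟨a, ⟨haS, Or.inr rfl⟩, hav⟩
      conn := hc.conn.mapEnds f1
        (by
          rintro u ⟨-, hu | rfl⟩
          · simp [f1, hu]
          · simp [f1]) (fun u hu => hu.1)
      deg := by rw [cutSize_mapEnds, f1v, hc.deg]
      two_le := by
        simp only [cross_mapEnds, f1v]
        exact hc.two_le }
  obtain ⟨c2, hc2⟩ : ∃ c2 : E → Fin k, ∀ e i, φ1 e = some i → c2 e = i :=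
    ⟨fun e => (φ1 e).getD ⟨0, hk⟩, fun e i h => by simp [h]⟩
  obtain ⟨φ2, hφ2⟩ := ih (mapEnds f2 g)
    (numNonloop_lt (fun e he => by simp [mapEnds, he]) he₂ (by simp [mapEnds, f2, h₂])) S2 v c2
    { mem := Or.inr rfl
      exists_ne := ⟨a, Or.inl ⟨haS, hXa⟩, hav⟩
      conn := hc.conn.mapEnds f2
        (by
          rintro u (⟨-, hu⟩ | rfl)
          · simp [f2, hu]
          · simp [f2])
        (by
          rintro u (⟨hu, -⟩ | rfl)
          · exact hu
          · exact hc.mem)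
      deg := by rw [cutSize_mapEnds, f2v, cutSize_not, hX]
      two_le := by
        intro i
        refine (hφ1.two_le i a ⟨haS, Or.inr rfl⟩ hav).trans (card_le_card fun e => ?_)
        simp only [cross_mapEnds, f1a, f2v, mem_filter, mem_univ, true_and, cross_not]
        exact fun h => ⟨h.1, hc2 e i h.2⟩ }
  have ext1 : ∀ e, Cross g (pt v) e → φ1 e = some (c e) := fun e he =>
    hφ1.extends_at e (by rwa [cross_mapEnds, f1v])
  have ext2 : ∀ e, Cross g X e → φ2 e = some (c2 e) := fun e he =>
    hφ2.extends_at e (by rwa [cross_mapEnds, f2v, cross_not])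
  let φ : E → Option (Fin k) := fun e => if X (g e).1 || X (g e).2 then φ2 e else φ1 e
  have hφ_touch : ∀ e, (X (g e).1 = true ∨ X (g e).2 = true) → φ e = φ2 e := fun e he => by
    simp [φ, he]
  have hφ_out : ∀ e i, (X (g e).1 = false ∨ X (g e).2 = false) → φ1 e = some i → φ e = some i := by
    intro e i he h1
    by_cases hcr : Cross g X e
    · have : X (g e).1 = true ∨ X (g e).2 = true := by
        cases h1 : X (g e).1 <;> cases h2 : X (g e).2 <;> simp_all
      rw [hφ_touch e this, ext2 e hcr, hc2 e i h1]
    · have : X (g e).1 = false ∧ X (g e).2 = false := by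
        cases h1 : X (g e).1 <;> cases h2 : X (g e).2 <;> simp_all
      simp [φ, this, h1]
  have hv_out : ∀ e, Cross g (pt v) e → (X (g e).1 = false ∨ X (g e).2 = false) := by
    intro e he
    rcases cross_pt.1 he with ⟨h, -⟩ | ⟨-, h⟩ <;> simp [h, hXv]
  refine ⟨φ, ⟨fun e he => hφ_out e _ (hv_out e he) (ext1 e he), ?_, ?_⟩⟩
  · intro i Y hY
    have haR2 : a ∈ spanTarget (mapEnds f2 g) S2 v c2 i := ⟨hav, Or.inl (Or.inl ⟨haS, hXa⟩)⟩
    have hR2 : ∀ u, X u = true → (∃ e, Cross g X e ∧ Cross g (pt u) e ∧ c2 e = i) →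
        u ∈ spanTarget (mapEnds f2 g) S2 v c2 i := by
      rintro u hu ⟨e, he, he', hi⟩
      refine ⟨fun h => by simp [h, hXv] at hu, Or.inr ⟨e, ?_, ?_, hi⟩⟩
      · rwa [cross_mapEnds, f2v, cross_not]
      · rwa [cross_mapEnds, f2u u hu]
    by_cases hsep : Sep (spanTarget (mapEnds f2 g) S2 v c2 i) Y
    · obtain ⟨e, he, hev, heY⟩ := hφ2.connects i Y hsep
      rw [cross_mapEnds, f2v, cross_not] at hev
      rw [cross_mapEnds] at heY
      have hin : X (g e).1 = true ∧ X (g e).2 = true := by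
        by_contra hno
        have : X (g e).1 = false ∧ X (g e).2 = false := by
          cases h1 : X (g e).1 <;> cases h2 : X (g e).2 <;> simp_all
        simp [Cross, f2, this] at heY
      refine ⟨e, by rw [hφ_touch e (Or.inl hin.1), he], fun hve => ?_, ?_⟩
      · rcases hv_out e hve with h | h <;> simp [hin] at h
      · simpa [Cross, f2, hin] using heY
    · have hconst : ∀ u ∈ spanTarget (mapEnds f2 g) S2 v c2 i, Y u = Y a := by
        intro u hu
        by_contra hne
        exact hsep (Sep.of_ne hu haR2 hne)
      let Y1 : V → Bool := fun w => if X w then Y a else Y w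
      have hY1f : Y1 ∘ f1 = Y1 := by
        ext w
        by_cases hw : X w <;> simp [Y1, f1, hw, hXa]
      obtain ⟨u, hu, huY⟩ : ∃ u ∈ spanTarget g S v c i, Y u ≠ Y a := by
        obtain ⟨⟨b, hb, hb'⟩, d, hd, hd'⟩ := hY
        cases hYa : Y a
        · exact ⟨b, hb, by simp [hb']⟩
        · exact ⟨d, hd, by simp [hd']⟩
      have huX : X u = false := by
        by_contra hXu
        rw [Bool.not_eq_false] at hXu
        apply huY
        apply hconst
        obtain ⟨huv, huS | ⟨e, he, he', hi⟩⟩ := hu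
        · exact ⟨huv, Or.inl (Or.inl ⟨huS, hXu⟩)⟩
        · refine hR2 u hXu ⟨e, ?_, he', by rw [hc2 e _ (ext1 e he), hi]⟩
          rcases cross_pt.1 he with ⟨h, h'⟩ | ⟨h', h⟩ <;>
            rcases cross_pt.1 he' with ⟨h3, h4⟩ | ⟨h3, h4⟩ <;> simp_all [Cross]
      have hsep1 : Sep (spanTarget (mapEnds f1 g) S1 v c i) Y1 := by
        refine Sep.of_ne (a := u) (b := a) ?_ ⟨hav, Or.inl ⟨haS, Or.inr rfl⟩⟩
          (by simpa [Y1, huX, hXa] using huY)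
        obtain ⟨huv, huS | ⟨e, he, he', hi⟩⟩ := hu
        · exact ⟨huv, Or.inl ⟨huS, Or.inl huX⟩⟩
        · refine ⟨huv, Or.inr ⟨e, ?_, ?_, hi⟩⟩
          · rwa [cross_mapEnds, f1v]
          · rwa [cross_mapEnds, f1u u huX]
      obtain ⟨e, he, hev, heY⟩ := hφ1.connects i Y1 hsep1
      rw [cross_mapEnds, f1v] at hev
      rw [cross_mapEnds, hY1f] at heY
      have hnin : X (g e).1 = false ∨ X (g e).2 = false := by
        by_contra! hno
        simp [Cross, Y1, hno] at heY
      refine ⟨e, hφ_out e i hnin he, hev, ?_⟩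
      have hYY : ∀ w, (X w = true → Cross g (pt w) e ∧ Cross g X e) → Y1 w = Y w := by
        intro w hw
        cases hXw : X w
        · simp [Y1, hXw]
        · simp only [Y1, hXw, if_true]
          obtain ⟨h1, h2⟩ := hw hXw
          exact (hconst w (hR2 w hXw ⟨e, h2, h1, hc2 e i he⟩)).symm
      have hne := heY.ne
      have e1 := hYY (g e).1 (fun h => by
        have : X (g e).2 = false := by simpa [h] using hnin
        exact ⟨cross_pt.2 (Or.inl ⟨rfl, hne.symm⟩), by simp [Cross, h, this]⟩)
      have e2 := hYY (g e).2 (fun h => by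
        have : X (g e).1 = false := by simpa [h] using hnin
        exact ⟨cross_pt.2 (Or.inr ⟨hne, rfl⟩), by simp [Cross, h, this]⟩)
      rwa [Cross, e1, e2] at heY
  · intro i u huS huv
    cases hXu : X u
    · refine (hφ1.two_le i u ⟨huS, Or.inl hXu⟩ huv).trans (card_le_card fun e => ?_)
      simp only [cross_mapEnds, f1u u hXu, mem_filter, mem_univ, true_and]
      rintro ⟨h1, h2⟩
      refine ⟨h1, hφ_out e i ?_ h2⟩
      rcases cross_pt.1 h1 with ⟨h, -⟩ | ⟨-, h⟩ <;> simp [h, hXu]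
    · refine (hφ2.two_le i u (Or.inl ⟨huS, hXu⟩) huv).trans (card_le_card fun e => ?_)
      simp only [cross_mapEnds, f2u u hXu, mem_filter, mem_univ, true_and]
      rintro ⟨h1, h2⟩
      refine ⟨h1, ?_⟩
      rw [hφ_touch e ?_, h2]
      rcases cross_pt.1 h1 with ⟨h, -⟩ | ⟨-, h⟩ <;> simp [h, hXu]

end Multigraph

section MinimalBad

variable {V E : Type*}

section Cuts

variable [Fintype E] (g : E → V × V)

open Finset in
theorem cutSize_inter_add_union (Y Z : V → Bool) :
    cutSize g (fun w => Y w && Z w) + cutSize g (fun w => Y w || Z w) ≤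
      cutSize g Y + cutSize g Z := by
  simp only [cutSize, card_filter, ← sum_add_distrib]
  refine sum_le_sum fun e _ => ?_
  have key : ∀ p q r s : Bool, (if (p && r) ≠ (q && s) then 1 else 0) +
      (if (p || r) ≠ (q || s) then 1 else 0) ≤
      (if p ≠ q then 1 else 0) + (if r ≠ s then 1 else 0) := by decide
  exact key _ _ _ _

open Finset in
theorem cutSize_diff_add_diff (Y Z : V → Bool) :
    cutSize g (fun w => Y w && !Z w) + cutSize g (fun w => Z w && !Y w) +
      2 * #{e | Cross g (fun w => Y w && Z w) e ∧ Cross g (fun w => Y w || Z w) e} ≤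
      cutSize g Y + cutSize g Z := by
  simp only [cutSize, card_filter, ← sum_add_distrib, mul_sum]
  refine sum_le_sum fun e _ => ?_
  have key : ∀ p q r s : Bool, (if (p && !r) ≠ (q && !s) then 1 else 0) +
      (if (r && !p) ≠ (s && !q) then 1 else 0) +
      2 * (if (p && r) ≠ (q && s) ∧ (p || r) ≠ (q || s) then 1 else 0) ≤
      (if p ≠ q then 1 else 0) + (if r ≠ s then 1 else 0) := by decide
  exact key _ _ _ _

open Finset in
theorem cutSize_union_of_disjoint {Y Z : V → Bool} (h : ∀ w, Y w = true → Z w = false) :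
    cutSize g (fun w => Y w || Z w) + 2 * #{e | Cross g Y e ∧ Cross g Z e} =
      cutSize g Y + cutSize g Z := by
  simp only [cutSize, card_filter, ← sum_add_distrib, mul_sum]
  refine sum_congr rfl fun e _ => ?_
  have key : ∀ p q r s : Bool, (p = true → r = false) → (q = true → s = false) →
      (if (p || r) ≠ (q || s) then 1 else 0) + 2 * (if p ≠ q ∧ r ≠ s then 1 else 0) =
      (if p ≠ q then 1 else 0) + (if r ≠ s then 1 else 0) := by decide
  exact key _ _ _ _ (h _) (h _)

end Cuts

section Star

variable [Fintype E] {g : E → V × V} {S : Set V} {N : ℕ}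

theorem CutConn.le_deg (hS : CutConn g S N) {t b : V} (ht : t ∈ S) (hb : b ∈ S) (h : b ≠ t) :
    N ≤ cutSize g (pt t) :=
  hS _ ⟨⟨t, ht, by simp⟩, b, hb, by simpa using h⟩

open Finset in
/-- A tight cut one of whose sides spans no edge is a star. -/
theorem star_of_no_inner_edge (hS : CutConn g S N) {X : V → Bool} (hX : Sep S X)
    (hXN : cutSize g X ≤ N)
    (hin : ∀ e, X (g e).1 = true → X (g e).2 = true → (g e).1 = (g e).2) :
    ∃ t ∈ S, X t = true ∧ (∀ e, Cross g X e ↔ Cross g (pt t) e) ∧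
      ∀ w, X w = true → w ≠ t → ∀ e, ¬ Cross g (pt w) e := by
  obtain ⟨⟨t, ht, htX⟩, b, hb, hbX⟩ := hX
  have hbt : b ≠ t := fun h => by simp [h, htX] at hbX
  have hsub : ∀ w, X w = true → ∀ e, Cross g (pt w) e → Cross g X e := by
    intro w hw e he
    rcases cross_pt.1 he with ⟨h1, h2⟩ | ⟨h2, h1⟩
    · intro hc
      rw [h1, hw] at hc
      exact h2 ((hin e (by rw [h1, hw]) hc.symm).symm.trans h1)
    · intro hc
      rw [h1, hw] at hc
      exact h2 ((hin e hc (by rw [h1, hw])).trans h1)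
  have heq : univ.filter (fun e => Cross g (pt t) e) = univ.filter (fun e => Cross g X e) :=
    eq_of_subset_of_card_le (fun e => by simpa using hsub t htX e)
      (hXN.trans (hS.le_deg ht hb hbt))
  have hiff : ∀ e, Cross g X e ↔ Cross g (pt t) e := fun e => by
    have := Finset.ext_iff.1 heq e
    simp only [mem_filter, mem_univ, true_and] at this
    exact this.symm
  refine ⟨t, ht, htX, hiff, fun w hw hwt e he => ?_⟩
  have h1 := hsub w hw e he
  have h2 := (hiff e).1 h1
  rcases cross_pt.1 he with ⟨h3, h4⟩ | ⟨h4, h3⟩ <;>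
    rcases cross_pt.1 h2 with ⟨h5, h6⟩ | ⟨h6, h5⟩ <;> simp_all [Cross]

end Star

section Joins

variable {g : E → V × V}

/-- `e` joins `a` and `b`. -/
def Joins (g : E → V × V) (e : E) (a b : V) : Prop := ∀ Y : V → Bool, Cross g Y e ↔ Y a ≠ Y b

theorem exists_joins {z : V} {e : E} (h : Cross g (pt z) e) : ∃ a, a ≠ z ∧ Joins g e z a := by
  rcases cross_pt.1 h with ⟨h1, h2⟩ | ⟨h2, h1⟩
  · exact ⟨_, h2, fun Y => by rw [← h1]⟩
  · exact ⟨_, h2, fun Y => by rw [← h1]; exact ne_comm⟩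

theorem Joins.cross_left {z a : V} {e : E} (h : Joins g e z a) (ha : a ≠ z) :
    Cross g (pt z) e := (h _).2 (by simp [pt, ha])

theorem Joins.cross_right {z a : V} {e : E} (h : Joins g e z a) (ha : a ≠ z) :
    Cross g (pt a) e := (h _).2 (by simp [pt, ha.symm])

theorem Joins.ne {z a : V} {e : E} (h : Joins g e z a) (ha : a ≠ z) : (g e).1 ≠ (g e).2 :=
  (h.cross_left ha).ne

/-- The ends of a nonloop edge are determined. -/
theorem Joins.cross_pt_iff {z a u : V} {e : E} (h : Joins g e z a) (ha : a ≠ z) :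
    Cross g (pt u) e ↔ u = z ∨ u = a := by
  rw [h (pt u)]
  by_cases h1 : u = z
  · subst h1; simp [pt, ha]
  · by_cases h2 : u = a
    · subst h2; simp [pt, ha.symm]
    · simp [pt, Ne.symm h1, Ne.symm h2, h1, h2]

/-- Replace the path `a - z - b` formed by `e` and `f` by an edge `e` from `a` to `b`. -/
noncomputable def splitOff (g : E → V × V) (e f : E) (a b : V) : E → V × V := by
  classical
  exact fun x => if x = f then (a, a) else if x = e then (a, b) else g x

theorem cross_splitOff {e f : E} {a b : V} (hef : e ≠ f) (Y : V → Bool) (x : E) :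
    Cross (splitOff g e f a b) Y x ↔ (x = e ∧ Y a ≠ Y b) ∨ (x ≠ e ∧ x ≠ f ∧ Cross g Y x) := by
  by_cases h1 : x = f
  · subst h1; simp [splitOff, Cross, hef.symm]
  · by_cases h2 : x = e
    · subst h2; simp [splitOff, Cross, h1]
    · simp [splitOff, Cross, h1, h2]

end Joins

/-- A pending extension problem: all smaller instances are solvable, this one is not. -/
structure IsMinimalBad [Fintype E] {k : ℕ} (g : E → V × V) (S : Set V) (v : V) (c : E → Fin k)
    (N : ℕ) : Prop extends IsColoring g S v c N where
  ih : ∀ g' : E → V × V, numNonloop g' < numNonloop g → ∀ (S : Set V) v (c : E → Fin k),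
    IsColoring g' S v c N → ∃ φ, IsExtension g' S v c φ
  bad : ¬ ∃ φ, IsExtension g S v c φ
  k_pos : 0 < k
  N_le : 7 * k ≤ N

section Bad

variable [Fintype E] {k N : ℕ} {g : E → V × V} {S : Set V} {v : V} {c : E → Fin k}

theorem IsMinimalBad.no_inner_edge (hb : IsMinimalBad g S v c N) {X : V → Bool} (hX : Sep S X)
    (hXN : cutSize g X ≤ N) :
    (∀ e, X (g e).1 = true → X (g e).2 = true → (g e).1 = (g e).2) ∨
      ∀ e, X (g e).1 = false → X (g e).2 = false → (g e).1 = (g e).2 := by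
  by_contra! hcon
  obtain ⟨⟨e₁, h1, h2, h3⟩, e₂, h4, h5, h6⟩ := hcon
  have hXN' : cutSize g X = N := le_antisymm hXN (hb.conn X hX)
  cases hXv : X v
  · obtain ⟨a, ha, haX⟩ := hX.1
    exact hb.bad (exists_extension_of_tight_cut hb.k_pos hb.toIsColoring hb.ih hXv ha haX hXN'
      h3 h6 ⟨h1, h2⟩ ⟨h4, h5⟩)
  · obtain ⟨a, ha, haX⟩ := hX.2
    exact hb.bad (exists_extension_of_tight_cut hb.k_pos hb.toIsColoring hb.ih
      (X := fun w => !X w) (by simp [hXv]) ha (by simp [haX]) (by rw [cutSize_not, hXN'])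
      h6 h3 (by simp [h4, h5]) (by simp [h1, h2]))

theorem IsMinimalBad.star (hb : IsMinimalBad g S v c N) {X : V → Bool} (hX : Sep S X)
    (hXN : cutSize g X ≤ N) {z : V} (hz : z ∉ S) (hzX : X z = false) {f : E}
    (hf : Cross g (pt z) f) :
    ∃ t ∈ S, X t = true ∧ (∀ e, Cross g X e ↔ Cross g (pt t) e) ∧
      ∀ w, X w = true → w ≠ t → ∀ e, ¬ Cross g (pt w) e := by
  rcases hb.no_inner_edge hX hXN with h | h
  · exact star_of_no_inner_edge hb.conn hX hXN h
  · exfalso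
    obtain ⟨t, ht, -, -, h2⟩ := star_of_no_inner_edge hb.conn hX.not
      (by rwa [cutSize_not]) (fun e h1 h2 => h e (by simpa using h1) (by simpa using h2))
    exact h2 z (by simp [hzX]) (fun h => hz (h ▸ ht)) f hf

open Finset in
/-- In a minimal bad instance no edge joins two vertices that are not terminals. -/
theorem IsMinimalBad.mem_of_joins (hb : IsMinimalBad g S v c N) {e : E} {p q : V}
    (he : Joins g e p q) (hpq : q ≠ p) (hp : p ∉ S) : q ∈ S := by
  classical
  by_contra hq
  let g' : E → V × V := Function.update g e (p, p)
  have hcr : ∀ Y x, Cross g' Y x ↔ Cross g Y x ∧ x ≠ e := by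
    intro Y x
    by_cases hx : x = e
    · subst hx; simp [g', Cross]
    · simp [g', Cross, hx]
  have hve : ¬ Cross g (pt v) e := by
    rw [he.cross_pt_iff hpq]
    rintro (h | h)
    · exact hp (h ▸ hb.mem)
    · exact hq (h ▸ hb.mem)
  have hcr_v : ∀ x, Cross g' (pt v) x ↔ Cross g (pt v) x := fun x => by
    rw [hcr]
    exact ⟨fun h => h.1, fun h => ⟨h, fun hx => hve (hx ▸ h)⟩⟩
  by_cases hconn : CutConn g' S N
  · obtain ⟨φ, hφ⟩ := hb.ih g'
      (numNonloop_lt (fun x hx => by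
        by_cases hxe : x = e
        · subst hxe; simp [g']
        · simpa [g', hxe] using hx) (he.ne hpq) (by simp [g'])) S v c
      { mem := hb.mem
        exists_ne := hb.exists_ne
        conn := hconn
        deg := by
          rw [← hb.deg]
          simp only [cutSize, hcr_v]
        two_le := by simpa only [hcr_v] using hb.two_le }
    refine hb.bad ⟨φ, ⟨fun x hx => hφ.extends_at x ((hcr_v x).2 hx), ?_, ?_⟩⟩
    · intro i Y hY
      have : spanTarget g S v c i = spanTarget g' S v c i := by
        ext u
        simp only [spanTarget, Set.mem_ofPred_eq, hcr_v]
        refine and_congr_right fun _ => or_congr_right (exists_congr fun x => ?_)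
        refine and_congr_right fun hx => ?_
        rw [hcr, and_iff_left (fun hxe => hve (by rwa [hxe] at hx))]
      rw [this] at hY
      obtain ⟨x, h1, h2, h3⟩ := hφ.connects i Y hY
      rw [hcr_v] at h2
      exact ⟨x, h1, h2, ((hcr Y x).1 h3).1⟩
    · intro i u hu huv
      refine (hφ.two_le i u hu huv).trans (card_le_card fun x => ?_)
      simp only [mem_filter, mem_univ, true_and, hcr]
      exact fun h => ⟨h.1.1, h.2⟩
  · simp only [CutConn, not_forall, not_le] at hconn
    obtain ⟨Y, hY, hlt⟩ := hconn
    have hle : cutSize g Y ≤ cutSize g' Y + 1 := by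
      refine (card_le_card (t := insert e (univ.filter fun x => Cross g' Y x)) fun x => ?_).trans
        (card_insert_le _ _)
      simp only [mem_filter, mem_univ, true_and, mem_insert, hcr]
      tauto
    have hYe : Cross g Y e := by
      by_contra hno
      have : cutSize g' Y = cutSize g Y := by
        simp only [cutSize, hcr]
        congr 1
        ext x
        simp only [mem_filter, mem_univ, true_and]
        exact ⟨fun h => h.1, fun h => ⟨h, fun hx => by rw [hx] at h; exact h hno⟩⟩
      have := hb.conn Y hY
      omega
    have hYN : cutSize g Y ≤ N := by omega
    have key : ∀ p q, p ∉ S → q ∉ S → q ≠ p → Joins g e p q → Y p = true → Y q = false →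
        False := by
      intro p q hp hq hpq he hYp hYq
      obtain ⟨t, ht, -, -, h⟩ := hb.star hY hYN hq hYq (he.cross_right hpq)
      exact h p hYp (fun h => hp (h ▸ ht)) e (he.cross_left hpq)
    have hYpq := (he Y).1 hYe
    cases hYp : Y p <;> cases hYq : Y q
    · exact hYpq (hYp.trans hYq.symm)
    · exact key q p hq hp hpq.symm (fun Z => (he Z).trans ne_comm) hYq hYp
    · exact key p q hp hq hpq he hYp hYq
    · exact hYpq (hYp.trans hYq.symm)

open Finset in
theorem IsMinimalBad.not_cutConn_splitOff (hb : IsMinimalBad g S v c N) {e f : E} {z a b : V}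
    (hef : e ≠ f) (hz : z ∉ S) (haz : a ≠ z) (hbz : b ≠ z) (he : Joins g e z a)
    (hf : Joins g f z b) (hbS : b ∈ S) (hbv : b ≠ v) :
    ¬ CutConn (splitOff g e f a b) S N := by
  classical
  intro hconn
  set g' := splitOff g e f a b with hg'
  have hzv : z ≠ v := fun h => hz (h ▸ hb.mem)
  have hfv : ¬ Cross g (pt v) f := by
    rw [hf.cross_pt_iff hbz]
    rintro (h | h)
    · exact hzv h.symm
    · exact hbv h.symm
  have hcr_v : ∀ x, Cross g' (pt v) x ↔ Cross g (pt v) x := fun x => by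
    rw [cross_splitOff hef]
    by_cases hxe : x = e
    · subst hxe
      rw [he.cross_pt_iff haz]
      by_cases hav : a = v
      · subst hav; simp [pt, hbv]
      · simp [pt, hav, hbv, hzv.symm, Ne.symm hav]
    · by_cases hxf : x = f
      · subst hxf; simp [hxe, hfv]
      · simp [hxe, hxf]
  obtain ⟨φ', hφ⟩ := hb.ih g'
    (numNonloop_lt (e := f) (fun x hx => by
      by_cases hxf : x = f
      · subst hxf; simp [g', splitOff]
      · by_cases hxe : x = e
        · subst hxe; exact absurd hx (he.ne haz)
        · simpa [g', splitOff, hxe, hxf] using hx) (hf.ne hbz) (by simp [g', splitOff])) S v c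
    { mem := hb.mem
      exists_ne := hb.exists_ne
      conn := hconn
      deg := by
        rw [← hb.deg]
        simp only [cutSize, hcr_v]
      two_le := by simpa only [hcr_v] using hb.two_le }
  let φ : E → Option (Fin k) := fun x => if x = f then φ' e else φ' x
  have hφf : φ f = φ' e := by simp [φ]
  have hφne : ∀ x, x ≠ f → φ x = φ' x := fun x hx => by simp [φ, hx]
  refine hb.bad ⟨φ, ⟨?_, ?_, ?_⟩⟩
  · intro x hx
    rw [hφne x (fun h => hfv (h ▸ hx))]
    exact hφ.extends_at x ((hcr_v x).2 hx)
  · intro i Y hY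
    have hbR : b ∈ spanTarget g' S v c i := ⟨hbv, Or.inl hbS⟩
    by_cases hsep : Sep (spanTarget g' S v c i) Y
    · obtain ⟨x, h1, h2, h3⟩ := hφ.connects i Y hsep
      have h2' := h2
      rw [hcr_v] at h2
      rw [cross_splitOff hef] at h3
      rcases h3 with ⟨rfl, h3⟩ | ⟨hxe, hxf, h3⟩
      · by_cases hYz : Y z = Y a
        · exact ⟨f, hφf.trans h1, hfv, (hf Y).2 (by rwa [hYz])⟩
        · exact ⟨x, (hφne x hef).trans h1, h2, (he Y).2 hYz⟩
      · exact ⟨x, (hφne x hxf).trans h1, h2, h3⟩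
    · have hconst : ∀ u ∈ spanTarget g' S v c i, Y u = Y b := by
        intro u hu
        by_contra hne
        exact hsep (Sep.of_ne hu hbR hne)
      obtain ⟨u, hu, huY⟩ : ∃ u ∈ spanTarget g S v c i, Y u ≠ Y b := by
        obtain ⟨⟨p, hp, hp'⟩, q, hq, hq'⟩ := hY
        cases hYb : Y b
        · exact ⟨p, hp, by simp [hp']⟩
        · exact ⟨q, hq, by simp [hq']⟩
      obtain ⟨huv, huS | ⟨x, hx, hx', hi⟩⟩ := hu
      · exact absurd (hconst u ⟨huv, Or.inl huS⟩) huY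
      · have hxf : x ≠ f := fun h => hfv (h ▸ hx)
        by_cases hxe : x = e
        · subst hxe
          have hva : v = a := by
            rcases (he.cross_pt_iff haz).1 hx with h | h
            · exact absurd h.symm hzv
            · exact h
          have huz : u = z := by
            rcases (he.cross_pt_iff haz).1 hx' with h | h
            · exact h
            · exact absurd (h.trans hva.symm) huv
          refine ⟨f, ?_, hfv, (hf Y).2 (huz ▸ huY)⟩
          rw [hφf, hφ.extends_at x ((hcr_v x).2 hx), hi]
        · refine absurd (hconst u ⟨huv, Or.inr ⟨x, (hcr_v x).2 hx, ?_, hi⟩⟩) huY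
          rw [cross_splitOff hef]
          exact Or.inr ⟨hxe, hxf, hx'⟩
  · intro i u hu huv
    refine (hφ.two_le i u hu huv).trans ?_
    refine card_le_card_of_injOn (fun x => if x = e ∧ u = b then f else x) ?_ ?_
    · intro x hx
      simp only [coe_filter, mem_univ, true_and, Set.mem_ofPred_eq] at hx ⊢
      obtain ⟨h1, h2⟩ := hx
      rw [cross_splitOff hef] at h1
      rcases h1 with ⟨rfl, h1⟩ | ⟨hxe, hxf, h1⟩
      · by_cases hub : u = b
        · simp only [hub, and_self, if_true]
          exact ⟨hf.cross_right hbz, hφf.trans h2⟩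
        · simp only [hub, and_false, if_false]
          refine ⟨(he.cross_pt_iff haz).2 (Or.inr ?_), (hφne x hef).trans h2⟩
          by_contra hua
          simp [pt, Ne.symm hua, Ne.symm hub] at h1
      · simp only [hxe, false_and, if_false]
        exact ⟨h1, (hφne x hxf).trans h2⟩
    · have hnf : ∀ x, Cross g' (pt u) x ∧ φ' x = some i → x ≠ f := by
        rintro x ⟨h1, -⟩ rfl
        rw [cross_splitOff hef] at h1
        rcases h1 with ⟨h, -⟩ | ⟨-, h, -⟩
        · exact hef h.symm
        · exact h rfl
      intro x hx y hy hxy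
      simp only [coe_filter, mem_univ, true_and, Set.mem_ofPred_eq] at hx hy
      have h1 := hnf x hx
      have h2 := hnf y hy
      simp only at hxy
      split_ifs at hxy with h3 h4 h4
      · exact h3.1.trans h4.1.symm
      · exact absurd hxy.symm h2
      · exact absurd hxy h1
      · exact hxy

end Bad

end MinimalBad

section Dangerous

variable {V E : Type*} [Fintype E] {k N : ℕ} {g : E → V × V} {S : Set V} {v : V} {c : E → Fin k}

open Finset in
theorem exists_dangerous_of_not_cutConn (hS : CutConn g S N) {e f : E} {z a b : V}
    (hef : e ≠ f) (he : Joins g e z a) (hf : Joins g f z b)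
    (hconn : ¬ CutConn (splitOff g e f a b) S N) :
    ∃ Y, Sep S Y ∧ Y z = false ∧ Y a = true ∧ Y b = true ∧ cutSize g Y ≤ N + 1 := by
  classical
  simp only [CutConn, not_forall, not_le] at hconn
  obtain ⟨Y, hY, hlt⟩ := hconn
  wlog hYz : Y z = false generalizing Y
  · exact this (fun w => !Y w) hY.not (by rwa [cutSize_not]) (by simpa using hYz)
  have hYN := hS Y hY
  have he' := he Y
  have hf' := hf Y
  have hcr := cross_splitOff (g := g) (a := a) (b := b) hef Y
  have hcard : ∀ x y : E, univ.filter (fun w => Cross g Y w) ⊆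
      insert x (insert y (univ.filter fun w => Cross (splitOff g e f a b) Y w)) →
      cutSize g Y ≤ N + 1 := fun x y h => by
    have h1 := (card_le_card h).trans ((card_insert_le _ _).trans
      (Nat.add_le_add_right (card_insert_le _ _) 1))
    unfold cutSize at hlt ⊢
    omega
  cases hYa : Y a <;> cases hYb : Y b
  · exfalso
    refine absurd (card_le_card (s := univ.filter fun w => Cross g Y w)
      (t := univ.filter fun w => Cross (splitOff g e f a b) Y w) fun x => ?_)
      (not_le.2 (lt_of_lt_of_le hlt hYN))
    simp only [mem_filter, mem_univ, true_and, hcr]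
    intro hx
    refine Or.inr ⟨fun h => ?_, fun h => ?_, hx⟩
    · rw [h] at hx; simp [he', hYz, hYa] at hx
    · rw [h] at hx; simp [hf', hYz, hYb] at hx
  · exfalso
    have h1 : ((univ.filter fun w => Cross g Y w).erase f) ⊆
        (univ.filter fun w => Cross (splitOff g e f a b) Y w).erase e := by
      intro x
      simp only [mem_erase, mem_filter, mem_univ, true_and, hcr]
      rintro ⟨hxf, hx⟩
      have : x ≠ e := fun h => by rw [h] at hx; simp [he', hYz, hYa] at hx
      exact ⟨this, Or.inr ⟨this, hxf, hx⟩⟩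
    have h2 := card_le_card h1
    rw [card_erase_of_mem (by simp [hf', hYz, hYb]),
      card_erase_of_mem (by simp only [mem_filter, mem_univ, true_and, hcr]; simp [hYa, hYb])] at h2
    have h3 : 0 < cutSize g Y := card_pos.2 ⟨f, by simp [hf', hYz, hYb]⟩
    have h4 : 0 < cutSize (splitOff g e f a b) Y := card_pos.2
      ⟨e, by simp only [mem_filter, mem_univ, true_and, hcr]; simp [hYa, hYb]⟩
    unfold cutSize at *
    omega
  · exfalso
    refine absurd (card_le_card (s := univ.filter fun w => Cross g Y w)
      (t := univ.filter fun w => Cross (splitOff g e f a b) Y w) fun x => ?_)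
      (not_le.2 (lt_of_lt_of_le hlt hYN))
    simp only [mem_filter, mem_univ, true_and, hcr]
    intro hx
    by_cases hxe : x = e
    · exact Or.inl ⟨hxe, by simp [hYa, hYb]⟩
    · refine Or.inr ⟨hxe, fun h => ?_, hx⟩
      rw [h] at hx; simp [hf', hYz, hYb] at hx
  · refine ⟨Y, hY, hYz, hYa, hYb, hcard e f fun x => ?_⟩
    simp only [mem_filter, mem_univ, true_and, hcr, mem_insert]
    tauto

open Finset in
theorem IsMinimalBad.exists_dangerous (hb : IsMinimalBad g S v c N) {e f : E} {z a b : V}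
    (hef : e ≠ f) (hz : z ∉ S) (haz : a ≠ z) (hbz : b ≠ z) (he : Joins g e z a)
    (hf : Joins g f z b) :
    ∃ Y, Sep S Y ∧ Y z = false ∧ Y a = true ∧ Y b = true ∧ cutSize g Y ≤ N + 1 := by
  have haS := hb.mem_of_joins he haz hz
  have hbS := hb.mem_of_joins hf hbz hz
  by_cases hbv : b = v
  · by_cases hav : a = v
    · refine exists_dangerous_of_not_cutConn hb.conn hef he hf fun hconn => ?_
      obtain ⟨u, hu, huv⟩ := hb.exists_ne
      have h1 := hconn.le_deg hb.mem hu huv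
      have h2 := hb.deg
      refine absurd (card_lt_card ((ssubset_iff_of_subset
        (s₁ := univ.filter fun w => Cross (splitOff g e f a b) (pt v) w)
        (s₂ := univ.filter fun w => Cross g (pt v) w) fun x => ?_).2 ⟨e, ?_, ?_⟩))
        (not_lt.2 (h2.le.trans h1))
      · simp only [mem_filter, mem_univ, true_and, cross_splitOff hef]
        rintro (⟨-, h⟩ | h)
        · exact absurd (by rw [hav, hbv]) h
        · exact h.2.2
      · simpa [hav] using he.cross_right haz
      · intro hc
        rw [mem_filter, cross_splitOff hef] at hc
        rcases hc.2 with ⟨-, h⟩ | h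
        · exact absurd (by rw [hav, hbv]) h
        · exact h.1 rfl
    · obtain ⟨Y, h1, h2, h3, h4, h5⟩ := exists_dangerous_of_not_cutConn hb.conn hef.symm hf he
        (hb.not_cutConn_splitOff hef.symm hz hbz haz hf he haS hav)
      exact ⟨Y, h1, h2, h4, h3, h5⟩
  · exact exists_dangerous_of_not_cutConn hb.conn hef he hf
      (hb.not_cutConn_splitOff hef hz haz hbz he hf hbS hbv)

open Finset in
/-- A dangerous set contains at most about half of the neighbours of a nonterminal. -/
theorem two_mul_card_le_of_dangerous (hS : CutConn g S N) {z : V} (hz : z ∉ S) {X : V → Bool}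
    (hX : Sep S X) (hXz : X z = false) (hXN : cutSize g X ≤ N + 1) :
    2 * #{e | Cross g X e ∧ Cross g (pt z) e} ≤ cutSize g (pt z) + 1 := by
  have h1 := cutSize_union_of_disjoint g (Y := X) (Z := pt z) (fun w hw => by
    simp only [pt_eq_false]
    rintro rfl
    simp [hXz] at hw)
  have h2 : Sep S (fun w => X w || pt z w) := by
    obtain ⟨⟨a, ha, ha'⟩, b, hb, hb'⟩ := hX
    refine ⟨⟨a, ha, by simp [ha']⟩, b, hb, ?_⟩
    have : b ≠ z := fun h => hz (h ▸ hb)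
    simp [hb', pt, this]
  have := hS _ h2
  omega

open Finset in
/-- In a minimal bad instance, nonterminals have degree at most three. -/
theorem IsMinimalBad.deg_le_three [Finite V] (hb : IsMinimalBad g S v c N) {z : V} (hz : z ∉ S) :
    cutSize g (pt z) ≤ 3 := by
  classical
  by_contra! hd
  set d := cutSize g (pt z) with hd_def
  -- the far end of an edge at `z`
  have hfar : ∀ e, ∃ a, Cross g (pt z) e → a ≠ z ∧ Joins g e z a := fun e => by
    by_cases h : Cross g (pt z) e
    · obtain ⟨a, ha⟩ := exists_joins h
      exact ⟨a, fun _ => ha⟩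
    · exact ⟨z, fun h' => absurd h' h⟩
  choose far hfar using hfar
  let D : Finset E := univ.filter fun e => Cross g (pt z) e
  have memD : ∀ e, e ∈ D ↔ Cross g (pt z) e := fun e => by simp [D]
  have hDd : #D = d := rfl
  have hne : ∀ e ∈ D, far e ≠ z := fun e he => (hfar e ((memD e).1 he)).1
  have hj : ∀ e ∈ D, Joins g e z (far e) := fun e he => (hfar e ((memD e).1 he)).2
  have hfS : ∀ e ∈ D, far e ∈ S := fun e he => hb.mem_of_joins (hj e he) (hne e he) hz
  have hcrD : ∀ (X : V → Bool), X z = false → ∀ e ∈ D, (Cross g X e ↔ X (far e) = true) :=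
    fun X hX e he => by
      rw [hj e he X, hX]
      cases X (far e) <;> simp
  let n : (V → Bool) → ℕ := fun X => #(D.filter fun e => X (far e) = true)
  have hn : ∀ X, Sep S X → X z = false → cutSize g X ≤ N + 1 → 2 * n X ≤ d + 1 := by
    intro X h1 h2 h3
    refine le_trans (le_of_eq ?_) (two_mul_card_le_of_dangerous hb.conn hz h1 h2 h3)
    change 2 * #(D.filter _) = _
    congr 2
    ext e
    simp only [mem_filter, mem_univ, true_and, memD]
    constructor
    · rintro ⟨h4, h5⟩
      exact ⟨(hcrD X h2 e ((memD e).2 h4)).2 h5, h4⟩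
    · rintro ⟨h4, h5⟩
      exact ⟨h5, (hcrD X h2 e ((memD e).2 h5)).1 h4⟩
  have hDne : D.Nonempty := card_pos.1 (by omega)
  -- a neighbour of largest multiplicity
  obtain ⟨e₀, he₀, hmax⟩ := exists_max_image D (fun e => n (pt (far e))) hDne
  set t := far e₀ with ht
  have hm : ∀ e ∈ D, n (pt (far e)) ≤ n (pt t) := hmax
  obtain ⟨e₁, he₁, he₁t⟩ : ∃ e ∈ D, far e ≠ t := by
    by_contra! hall
    obtain ⟨f, hf, hfe⟩ := exists_mem_ne (s := D) (by omega) e₀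
    obtain ⟨Y, h1, h2, h3, -, h5⟩ := hb.exists_dangerous hfe.symm hz (hne _ he₀) (hne _ hf)
      (hj _ he₀) (hj _ hf)
    have := hn Y h1 h2 h5
    have h6 : n Y = d := by
      rw [← hDd]
      refine congrArg card (filter_eq_self.2 ?_)
      intro e he
      rw [hall e he]
      exact h3
    omega
  set a := far e₁ with ha
  -- a dangerous set through `t` and `a` with as many neighbours of `z` as possible
  obtain ⟨X, ⟨hX, hXz, hXt, hXa, hXN⟩, hXmax⟩ := Set.exists_max_image
    {X | Sep S X ∧ X z = false ∧ X t = true ∧ X a = true ∧ cutSize g X ≤ N + 1} n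
    (Set.toFinite _)
    (hb.exists_dangerous (fun h => he₁t (by rw [ha, ← h])) hz (hne _ he₀) (hne _ he₁) (hj _ he₀)
      (hj _ he₁))
  have hnX := hn X hX hXz hXN
  have haS : a ∈ S := hfS e₁ he₁
  have htS : t ∈ S := hfS e₀ he₀
  -- consequences of an edge that leaves `X`
  have key : ∀ f ∈ D, X (far f) = false → n (pt t) ≤ 1 ∧ cutSize g (pt t) = N ∧
      2 * #{e | Cross g (pt t) e ∧ Cross g (pt a) e} + 1 = N ∧
      2 * #{e | Cross g (pt t) e ∧ Cross g (pt (far f)) e} + 1 = N := by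
    intro f hf hfX
    set b := far f with hb_def
    have hbS : b ∈ S := hfS f hf
    obtain ⟨Y, hY, hYz, hYt, hYb, hYN⟩ := hb.exists_dangerous (e := e₀) (f := f)
      (fun h => by rw [ht, h, ← hb_def, hfX] at hXt; simp at hXt) hz (hne _ he₀)
      (hne _ hf) (hj _ he₀) (hj _ hf)
    rw [← ht] at hYt
    rw [← hb_def] at hYb
    have hpos := cutSize_diff_add_diff g X Y
    have hsub := cutSize_inter_add_union g X Y
    set I : V → Bool := fun w => X w && Y w with hI
    set U : V → Bool := fun w => X w || Y w with hU
    have hnI : n I ≤ #{e | Cross g I e ∧ Cross g U e} := by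
      refine card_le_card fun e => ?_
      simp only [mem_filter, mem_univ, true_and]
      rintro ⟨heD, heI⟩
      have hIX : X (far e) = true ∧ Y (far e) = true := by simpa [I] using heI
      exact ⟨(hcrD I (by simp [I, hXz]) e heD).2 heI,
        (hcrD U (by simp [U, hXz, hYz]) e heD).2 (by simp [U, hIX])⟩
    have htI : I t = true := by simp [I, hXt, hYt]
    have hmI : n (pt t) ≤ n I := card_le_card fun e => by
      simp only [mem_filter, pt_eq_true]
      rintro ⟨h1, h2⟩
      exact ⟨h1, by rw [h2, htI]⟩
    have hm1 : 1 ≤ n (pt t) := card_pos.2 ⟨e₀, by simp [he₀, ← ht]⟩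
    have hXY : ∀ Z W : V → Bool, Sep S Z → Sep S W → (∀ s ∈ S, Z s = true ∨ W s = true) →
        Sep S (fun w => Z w && !W w) := by
      rintro Z W - ⟨⟨p, hp, hp'⟩, q, hq, hq'⟩ hall
      refine ⟨⟨q, hq, ?_⟩, p, hp, by simp [hp']⟩
      have := hall q hq
      simp [hq'] at this
      simp [hq', this]
    have hstar : ∀ Z : V → Bool, Sep S Z → cutSize g Z ≤ N → Z z = false → n Z ≤ n (pt t) := by
      intro Z h1 h2 h3
      obtain ⟨t', ht', hZt', -, h4⟩ := hb.star h1 h2 hz h3 ((memD e₀).1 he₀)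
      by_cases hcase : ∃ e ∈ D, Z (far e) = true
      · obtain ⟨e, he, heZ⟩ := hcase
        have hall : ∀ x ∈ D, Z (far x) = true → far x = t' := by
          intro x hx hxZ
          by_contra hxt
          exact h4 _ hxZ hxt x ((hj x hx).cross_right (hne x hx))
        refine le_trans (card_le_card fun x => ?_) (hm e he)
        simp only [mem_filter, pt_eq_true]
        rintro ⟨hx, hxZ⟩
        exact ⟨hx, by rw [hall x hx hxZ, hall e he heZ]⟩
      · push Not at hcase
        have : n Z = 0 := by
          rw [card_eq_zero, filter_eq_empty_iff]
          exact hcase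
        omega
    by_cases hSU : ∀ s ∈ S, X s = true ∨ Y s = true
    · exfalso
      have hs1 := hXY X Y hX hY hSU
      have hs2 := hXY Y X hY hX (fun s hs => (hSU s hs).symm)
      have h1 := hb.conn _ hs1
      have h2 := hb.conn _ hs2
      have h3 := hstar _ hs1 (by omega) (by simp [hXz])
      have h4 := hstar _ hs2 (by omega) (by simp [hYz])
      have h5 : #D ≤ n I + n (fun w => X w && !Y w) + n (fun w => Y w && !X w) := by
        refine (card_le_card (t := (D.filter fun e => I (far e) = true) ∪
          (D.filter fun e => (X (far e) && !Y (far e)) = true) ∪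
          D.filter fun e => (Y (far e) && !X (far e)) = true) fun e he => ?_).trans
          ((card_union_le _ _).trans (Nat.add_le_add_right (card_union_le _ _) _))
        have := hSU _ (hfS e he)
        simp only [mem_union, mem_filter, he, true_and, I]
        cases h1 : X (far e) <;> cases h2 : Y (far e) <;> simp_all
      omega
    · push Not at hSU
      obtain ⟨s, hsS, hsX, hsY⟩ := hSU
      have hsX : X s = false := by simpa using hsX
      have hsY : Y s = false := by simpa using hsY
      have hsepU : Sep S U := ⟨⟨t, htS, by simp [U, hXt]⟩, s, hsS, by simp [U, hsX, hsY]⟩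
      have hsepI : Sep S I := ⟨⟨t, htS, htI⟩, s, hsS, by simp [I, hsX]⟩
      have hUN : N + 2 ≤ cutSize g U := by
        by_contra! hlt
        have h1 := hXmax U ⟨hsepU, by simp [U, hXz, hYz], by simp [U, hXt], by simp [U, hXa],
          by omega⟩
        refine absurd h1 (not_le.2 (card_lt_card ((ssubset_iff_of_subset fun e => ?_).2
          ⟨f, ?_, ?_⟩)))
        · simp only [mem_filter, U]
          rintro ⟨h2, h3⟩
          exact ⟨h2, by simp [h3]⟩
        · simp [U, hf, ← hb_def, hYb]
        · simp [← hb_def, hfX]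
      have hIN := hb.conn I hsepI
      have hIstar := hb.star hsepI (by omega) hz (by simp [I, hXz]) ((memD e₀).1 he₀)
      obtain ⟨t', -, -, hIt, hIiso⟩ := hIstar
      have htt' : t = t' := by
        by_contra hne'
        exact hIiso t htI hne' e₀ ((hj _ he₀).cross_right (hne _ he₀))
      subst htt'
      have hIa : I a = false := by
        by_contra hIa
        rw [Bool.not_eq_false] at hIa
        exact hIiso a hIa he₁t e₁ ((hj _ he₁).cross_right (hne _ he₁))
      have hYa : Y a = false := by simpa [I, hXa] using hIa
      have hs1 : Sep S (fun w => X w && !Y w) :=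
        ⟨⟨a, haS, by simp [hXa, hYa]⟩, t, htS, by simp [hYt]⟩
      have hs2 : Sep S (fun w => Y w && !X w) :=
        ⟨⟨b, hbS, by simp [hYb, hfX]⟩, t, htS, by simp [hXt]⟩
      have h1 := hb.conn _ hs1
      have h2 := hb.conn _ hs2
      obtain ⟨a', -, -, hAt, hAiso⟩ := hb.star hs1 (by omega) hz (by simp [hXz])
        ((memD e₀).1 he₀)
      obtain ⟨b', -, -, hBt, hBiso⟩ := hb.star hs2 (by omega) hz (by simp [hYz])
        ((memD e₀).1 he₀)
      have haa' : a = a' := by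
        by_contra hne'
        exact hAiso a (by simp [hXa, hYa]) hne' e₁ ((hj _ he₁).cross_right (hne _ he₁))
      have hbb' : b = b' := by
        by_contra hne'
        exact hBiso b (by simp [hYb, hfX]) hne' f ((hj _ hf).cross_right (hne _ hf))
      subst haa'
      subst hbb'
      have hXdec := cutSize_union_of_disjoint g (Y := I) (Z := fun w => X w && !Y w)
        (fun w hw => by
          have : X w = true ∧ Y w = true := by simpa [I] using hw
          simp [this])
      have hYdec := cutSize_union_of_disjoint g (Y := I) (Z := fun w => Y w && !X w)
        (fun w hw => by
          have : X w = true ∧ Y w = true := by simpa [I] using hw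
          simp [this])
      have eX : (fun w => I w || (X w && !Y w)) = X := by
        ext w
        cases h1 : X w <;> cases h2 : Y w <;> simp [I, h1, h2]
      have eY : (fun w => I w || (Y w && !X w)) = Y := by
        ext w
        cases h1 : X w <;> cases h2 : Y w <;> simp [I, h1, h2]
      rw [eX] at hXdec
      rw [eY] at hYdec
      simp only [hIt, hAt] at hXdec
      simp only [hIt, hBt] at hYdec
      have hIt' : cutSize g (pt t) = cutSize g I := by
        simp only [cutSize, hIt]
      have := hb.conn _ hX
      have := hb.conn _ hY
      refine ⟨by omega, by omega, by omega, by omega⟩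
  -- two different neighbours outside `X`
  have hout : 1 < #(D.filter fun e => X (far e) = false) := by
    have h1 := card_filter_add_card_filter_not (s := D) (fun e => X (far e) = true)
    simp only [Bool.not_eq_true] at h1
    have h2 : n X = #(D.filter fun e => X (far e) = true) := rfl
    omega
  obtain ⟨f₁, hf₁, f₂, hf₂, hff⟩ := one_lt_card.1 hout
  simp only [mem_filter] at hf₁ hf₂
  obtain ⟨hm1, hdt, hta, htb⟩ := key f₁ hf₁.1 hf₁.2
  obtain ⟨-, -, -, htc⟩ := key f₂ hf₂.1 hf₂.2
  set b := far f₁ with hb_def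
  set b' := far f₂ with hb'_def
  have hbb' : b ≠ b' := by
    intro h
    have h1 := hm f₁ hf₁.1
    have : 1 < n (pt (far f₁)) := one_lt_card.2
      ⟨f₁, by simp [hf₁.1], f₂, by simp [hf₂.1, ← hb'_def, ← hb_def, h], hff⟩
    omega
  have hab : a ≠ b := fun h => by rw [h, hf₁.2] at hXa; simp at hXa
  have hab' : a ≠ b' := fun h => by rw [h, hf₂.2] at hXa; simp at hXa
  have hdisj : ∀ p q : V, p ≠ q → p ≠ t → q ≠ t → Disjoint
      (univ.filter fun e => Cross g (pt t) e ∧ Cross g (pt p) e)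
      (univ.filter fun e => Cross g (pt t) e ∧ Cross g (pt q) e) := by
    intro p q hpq hpt hqt
    rw [disjoint_filter]
    rintro e - ⟨h1, h2⟩ ⟨-, h3⟩
    obtain ⟨r, hr, hjr⟩ := exists_joins h1
    have h4 := ((hjr.cross_pt_iff hr).1 h2).resolve_left hpt
    have h5 := ((hjr.cross_pt_iff hr).1 h3).resolve_left hqt
    exact hpq (h4.trans h5.symm)
  have hbt : b ≠ t := fun h => by rw [← h, hf₁.2] at hXt; simp at hXt
  have hb't : b' ≠ t := fun h => by rw [← h, hf₂.2] at hXt; simp at hXt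
  have h1 := card_union_of_disjoint (hdisj a b hab he₁t hbt)
  have h2 := card_union_of_disjoint (disjoint_union_left.2
    ⟨hdisj a b' hab' he₁t hb't, hdisj b b' hbb' hbt hb't⟩)
  have h3 := card_le_card (s := (univ.filter fun e => Cross g (pt t) e ∧ Cross g (pt a) e) ∪
    (univ.filter fun e => Cross g (pt t) e ∧ Cross g (pt b) e) ∪
    (univ.filter fun e => Cross g (pt t) e ∧ Cross g (pt b') e))
    (t := univ.filter fun e => Cross g (pt t) e) (by
      intro e
      simp only [mem_union, mem_filter, mem_univ, true_and]
      tauto)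
  have h4 : cutSize g (pt t) = #{e | Cross g (pt t) e} := rfl
  have := hb.k_pos
  have := hb.N_le
  omega

end Dangerous

section Owner

variable {V E : Type*} {g : E → V × V} {S : Set V}

open scoped Classical in
/-- Edges are grouped by their end outside `S`, if there is one. -/
noncomputable def owner (g : E → V × V) (S : Set V) (e : E) : V ⊕ E :=
  if h : ∃ z, z ∉ S ∧ Cross g (pt z) e then Sum.inl h.choose else Sum.inr e

/-- No edge joins two vertices outside `S`. -/
def OutsideIndependent (g : E → V × V) (S : Set V) : Prop :=
  ∀ e p q, Joins g e p q → q ≠ p → p ∉ S → q ∈ S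

theorem owner_eq_inl_iff (hI : OutsideIndependent g S) {e : E} {z : V} :
    owner g S e = Sum.inl z ↔ z ∉ S ∧ Cross g (pt z) e := by
  unfold owner
  split_ifs with h
  · rw [Sum.inl.injEq]
    constructor
    · rintro rfl
      exact h.choose_spec
    · rintro ⟨h1, h2⟩
      obtain ⟨h3, h4⟩ := h.choose_spec
      obtain ⟨a, ha, hj⟩ := exists_joins h2
      refine ((hj.cross_pt_iff ha).1 h4).resolve_right fun h5 => h3 ?_
      rw [h5]
      exact hI e z a hj ha h1
  · simp only [false_iff]
    exact fun h' => h ⟨z, h'⟩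

theorem owner_eq_inr {e e' : E} (h : owner g S e = Sum.inr e') :
    e' = e ∧ ∀ z, Cross g (pt z) e → z ∈ S := by
  unfold owner at h
  split_ifs at h with h'
  · refine ⟨(Sum.inr.inj h).symm, fun z hz => ?_⟩
    by_contra hzS
    exact h' ⟨z, hzS, hz⟩

/-- Edges at two different terminals with the same owner span a path between the terminals. -/
theorem cross_or_cross_of_owner_eq (hI : OutsideIndependent g S) {e e' : E}
    (h : owner g S e = owner g S e') {u u' : V} (hu : u ∈ S) (hu' : u' ∈ S)
    (he : Cross g (pt u) e) (he' : Cross g (pt u') e') {Y : V → Bool} (hY : Y u ≠ Y u') :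
    Cross g Y e ∨ Cross g Y e' := by
  have huu : u' ≠ u := fun hc => hY (by rw [hc])
  rcases hx : owner g S e' with z | f
  · rw [hx] at h
    obtain ⟨hz, hze⟩ := (owner_eq_inl_iff hI).1 h
    obtain ⟨-, hze'⟩ := (owner_eq_inl_iff hI).1 hx
    obtain ⟨a, ha, hj⟩ := exists_joins hze
    obtain ⟨a', ha', hj'⟩ := exists_joins hze'
    have h1 := ((hj.cross_pt_iff ha).1 he).resolve_left (fun hc => hz (hc ▸ hu))
    have h2 := ((hj'.cross_pt_iff ha').1 he').resolve_left (fun hc => hz (hc ▸ hu'))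
    subst h1 h2
    rw [hj Y, hj' Y]
    by_contra! hcon
    exact hY (hcon.1.symm.trans hcon.2)
  · rw [hx] at h
    obtain ⟨rfl, -⟩ := owner_eq_inr h
    obtain ⟨rfl, -⟩ := owner_eq_inr hx
    obtain ⟨a, ha, hj⟩ := exists_joins he
    have h1 := ((hj.cross_pt_iff ha).1 he').resolve_left huu
    subst h1
    exact Or.inl ((hj Y).2 hY)

end Owner

section Base

variable {V E : Type*} [Fintype E] {g : E → V × V} {S : Set V}

open Finset in
/-- Nonterminals of degree at most three can be put on a side of a cut so that at most one of
their edges crosses it. -/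
theorem exists_cut_of_deg_le_three (hI : OutsideIndependent g S)
    (hd : ∀ z, z ∉ S → cutSize g (pt z) ≤ 3) (Y : V → Bool) (hY : ∀ z, z ∉ S → Y z = false) :
    ∃ Z : V → Bool, (∀ u ∈ S, Z u = Y u) ∧
      Set.InjOn (owner g S) {e | Cross g Z e} ∧
      ∀ e, Cross g Z e → (∃ e' u, owner g S e' = owner g S e ∧ u ∈ S ∧ Cross g (pt u) e' ∧
        Y u = true) ∧ ∃ e' u, owner g S e' = owner g S e ∧ u ∈ S ∧ Cross g (pt u) e' ∧
        Y u = false := by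
  classical
  let A : V → Finset E := fun z => {e | Cross g (pt z) e ∧ Cross g Y e}
  let B : V → Finset E := fun z => {e | Cross g (pt z) e ∧ ¬ Cross g Y e}
  have hAB : ∀ z, #(A z) + #(B z) = cutSize g (pt z) := fun z => by
    simp only [A, B, ← filter_filter]
    exact card_filter_add_card_filter_not _
  let Z : V → Bool := fun w => if w ∈ S then Y w else decide (#(B w) < #(A w))
  have hZS : ∀ u ∈ S, Z u = Y u := fun u hu => by simp [Z, hu]
  have hcr : ∀ e z, z ∉ S → Cross g (pt z) e → Cross g Z e →
      (Z z = true ∧ e ∈ B z) ∨ (Z z = false ∧ e ∈ A z) := by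
    intro e z hz he heZ
    obtain ⟨a, ha, hj⟩ := exists_joins he
    rw [hj Z, hZS a (hI e z a hj ha hz)] at heZ
    simp only [A, B, mem_filter, mem_univ, true_and]
    rw [hj Y, hY z hz]
    cases h1 : Z z <;> cases h2 : Y a <;> simp_all
  have hZz : ∀ z, z ∉ S → (Z z = true ↔ #(B z) < #(A z)) := fun z hz => by simp [Z, hz]
  have hfar : ∀ z, z ∉ S → ∀ e, Cross g (pt z) e →
      ∃ u ∈ S, Cross g (pt u) e ∧ (Cross g Y e ↔ Y u = true) := by
    intro z hz e he
    obtain ⟨a, ha, hj⟩ := exists_joins he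
    refine ⟨a, hI e z a hj ha hz, hj.cross_right ha, ?_⟩
    rw [hj Y, hY z hz]
    cases Y a <;> simp
  refine ⟨Z, hZS, ?_, ?_⟩
  · intro e he e' he' hee
    rcases hx : owner g S e with z | f
    · obtain ⟨hz, hze⟩ := (owner_eq_inl_iff hI).1 hx
      obtain ⟨-, hze'⟩ := (owner_eq_inl_iff hI).1 (hee.symm.trans hx)
      by_contra hne
      have h3 := hd z hz
      have h4 := hAB z
      rcases hcr e z hz hze he with ⟨h1, h2⟩ | ⟨h1, h2⟩ <;>
        rcases hcr e' z hz hze' he' with ⟨h1', h2'⟩ | ⟨h1', h2'⟩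
      · have := (hZz z hz).1 h1
        have := one_lt_card.2 ⟨e, h2, e', h2', hne⟩
        omega
      · simp [h1] at h1'
      · simp [h1] at h1'
      · have := mt (hZz z hz).2 (by simp [h1])
        have := one_lt_card.2 ⟨e, h2, e', h2', hne⟩
        omega
    · exact (owner_eq_inr hx).1.symm.trans (owner_eq_inr (hee.symm.trans hx)).1
  · intro e he
    rcases hx : owner g S e with z | f
    · obtain ⟨hz, hze⟩ := (owner_eq_inl_iff hI).1 hx
      have hpos : (A z).Nonempty ∧ (B z).Nonempty := by
        rw [← card_pos, ← card_pos]
        rcases hcr e z hz hze he with ⟨h1, h2⟩ | ⟨h1, h2⟩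
        · have := (hZz z hz).1 h1
          have := card_pos.2 ⟨e, h2⟩
          omega
        · have := mt (hZz z hz).2 (by simp [h1])
          have := card_pos.2 ⟨e, h2⟩
          omega
      obtain ⟨⟨e₁, he₁⟩, e₂, he₂⟩ := hpos
      simp only [A, B, mem_filter, mem_univ, true_and] at he₁ he₂
      obtain ⟨u₁, h1, h2, h3⟩ := hfar z hz e₁ he₁.1
      obtain ⟨u₂, h4, h5, h6⟩ := hfar z hz e₂ he₂.1
      refine ⟨⟨e₁, u₁, (owner_eq_inl_iff hI).2 ⟨hz, he₁.1⟩, h1, h2, h3.1 he₁.2⟩,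
        e₂, u₂, (owner_eq_inl_iff hI).2 ⟨hz, he₂.1⟩, h4, h5, ?_⟩
      simpa using mt h6.2 he₂.2
    · obtain ⟨-, hin⟩ := owner_eq_inr hx
      have hne := he.ne
      have hc1 : Cross g (pt (g e).1) e := cross_pt.2 (Or.inl ⟨rfl, hne.symm⟩)
      have hc2 : Cross g (pt (g e).2) e := cross_pt.2 (Or.inr ⟨hne, rfl⟩)
      have h1 := hin _ hc1
      have h2 := hin _ hc2
      have heY : Y (g e).1 ≠ Y (g e).2 := by rwa [Cross, hZS _ h1, hZS _ h2] at he
      cases hY1 : Y (g e).1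
      · exact ⟨⟨e, _, hx, h2, hc2, by cases h : Y (g e).2 <;> simp_all⟩, e, _, hx, h1, hc1, hY1⟩
      · exact ⟨⟨e, _, hx, h1, hc1, hY1⟩, e, _, hx, h2, hc2, by
          cases h : Y (g e).2 <;> simp_all⟩

end Base

section Base

variable {V E : Type*} [Fintype V] [Fintype E] {k N : ℕ} {g : E → V × V} {S : Set V} {v : V}
  {c : E → Fin k}

open Finset in
/-- If the nonterminals are independent and have degree at most three, then the hypergraph packing
theorem gives an extension. -/
theorem IsColoring.exists_extension_of_deg_le_three (hN : 7 * k ≤ N) (hc : IsColoring g S v c N)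
    (hI : OutsideIndependent g S) (hd : ∀ z, z ∉ S → cutSize g (pt z) ≤ 3) :
    ∃ φ, IsExtension g S v c φ := by
  classical
  let T : Type _ := {u : V // u ∈ S ∧ u ≠ v}
  obtain ⟨u₀, hu₀, hu₀v⟩ := hc.exists_ne
  have : Nonempty T := ⟨⟨u₀, hu₀, hu₀v⟩⟩
  let h : V ⊕ E → Finset T := fun x => {u | ∃ e, owner g S e = x ∧ Cross g (pt u.1) e}
  have mem_h : ∀ {x} {u : T}, u ∈ h x ↔ ∃ e, owner g S e = x ∧ Cross g (pt u.1) e := by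
    simp [h]
  let κ : V ⊕ E → Option (Fin k) := fun x =>
    if h : ∃ e, owner g S e = x ∧ Cross g (pt v) e then some (c h.choose) else none
  have κ_ne : ∀ {x}, κ x ≠ none ↔ ∃ e, owner g S e = x ∧ Cross g (pt v) e := by
    intro x
    by_cases hx : ∃ e, owner g S e = x ∧ Cross g (pt v) e <;> simp [κ, hx]
  -- an edge at `v` determines the unique terminal next to it
  have far_unique : ∀ {e} {u u' : V}, u ∈ S → u' ∈ S → u ≠ u' → Cross g (pt u) e →
      Cross g (pt u') e → ∀ w, Cross g (pt w) e → w = u ∨ w = u' := by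
    intro e u u' hu hu' huu h1 h2 w hw
    obtain ⟨a, ha, hj⟩ := exists_joins h1
    have h3 := ((hj.cross_pt_iff ha).1 h2).resolve_left huu.symm
    subst h3
    exact (hj.cross_pt_iff ha).1 hw
  have hcut : ∀ Y : Finset T, Y.Nonempty →
      N ≤ #{x | (∃ a ∈ h x, a ∈ Y) ∧ (κ x ≠ none ∨ ∃ b ∈ h x, b ∉ Y)} := by
    rintro Y ⟨y, hy⟩
    let YV : V → Bool := fun w => decide (∃ u ∈ Y, u.1 = w)
    obtain ⟨Z, hZS, hinj, hZ⟩ := exists_cut_of_deg_le_three hI hd YV (by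
      intro z hz
      simp only [YV, decide_eq_false_iff_not]
      rintro ⟨u, -, rfl⟩
      exact hz u.2.1)
    have hsep : Sep S Z := by
      refine ⟨⟨y.1, y.2.1, ?_⟩, v, hc.mem, ?_⟩
      · rw [hZS _ y.2.1]
        simpa only [YV, decide_eq_true_eq] using ⟨y, hy, rfl⟩
      · rw [hZS _ hc.mem]
        simp only [YV, decide_eq_false_iff_not]
        rintro ⟨u, -, hu⟩
        exact u.2.2 hu
    refine (hc.conn Z hsep).trans (card_le_card_of_injOn (owner g S) (fun e he => ?_)
      (by simpa using hinj))
    simp only [coe_filter, mem_univ, true_and] at he ⊢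
    obtain ⟨⟨e₁, u₁, h1, h2, h3, h4⟩, e₂, u₂, h5, h6, h7, h8⟩ := hZ e he
    simp only [YV, decide_eq_true_eq] at h4
    obtain ⟨a, ha, rfl⟩ := h4
    refine ⟨⟨a, mem_h.2 ⟨e₁, h1, h3⟩, ha⟩, ?_⟩
    by_cases hu₂ : u₂ = v
    · exact Or.inl (κ_ne.2 ⟨e₂, h5, hu₂ ▸ h7⟩)
    · refine Or.inr ⟨⟨u₂, h6, hu₂⟩, mem_h.2 ⟨e₂, h5, h7⟩, fun hc => ?_⟩
      simp only [YV, decide_eq_false_iff_not] at h8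
      exact h8 ⟨_, hc, rfl⟩
  -- every item at `v` has exactly one edge at `v` and at least one further edge
  have hsub : univ.filter (fun x => κ x ≠ none) ⊆
      (univ.filter fun e => Cross g (pt v) e).image (owner g S) := by
    intro x hx
    obtain ⟨e, rfl, he⟩ := κ_ne.1 (mem_filter.1 hx).2
    exact mem_image_of_mem _ (by simpa using he)
  have hall := hcut univ univ_nonempty
  simp only [mem_univ, and_true, not_true_eq_false, and_false, exists_false, or_false] at hall
  have hsub' : (univ.filter fun x => (∃ a, a ∈ h x) ∧ κ x ≠ none) ⊆
      univ.filter fun x => κ x ≠ none := by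
    intro x hx
    simp only [mem_filter, mem_univ, true_and] at hx ⊢
    exact hx.2
  have hdeg' : #(univ.filter fun e => Cross g (pt v) e) = N := hc.deg
  have hle1 := card_le_card hsub'
  have hle2 := card_le_card hsub
  have hle3 := card_image_le (s := univ.filter fun e => Cross g (pt v) e) (f := owner g S)
  have hdeg : #(univ.filter fun x => κ x ≠ none) = N := by omega
  have howner : Set.InjOn (owner g S) {e | Cross g (pt v) e} := by
    have := card_image_iff.1 (show #((univ.filter fun e => Cross g (pt v) e).image (owner g S)) =
      #(univ.filter fun e => Cross g (pt v) e) by omega)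
    simpa using this
  have hne : ∀ x, κ x ≠ none → (h x).Nonempty := by
    intro x hx
    have := eq_of_subset_of_card_le hsub' (by omega)
    have hx' : x ∈ univ.filter fun x => κ x ≠ none := by simpa using hx
    rw [← this] at hx'
    exact (mem_filter.1 hx').2.1
  have hκ : ∀ e, Cross g (pt v) e → κ (owner g S e) = some (c e) := by
    intro e he
    have hex : ∃ e', owner g S e' = owner g S e ∧ Cross g (pt v) e' := ⟨e, rfl, he⟩
    have := howner hex.choose_spec.2 he hex.choose_spec.1
    simp only [κ, dif_pos hex, this]
  -- items with two ends contain no edge between `v` and a terminal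
  have hnv : ∀ {e} {u : T}, 2 ≤ #(h (owner g S e)) → Cross g (pt u.1) e → ¬ Cross g (pt v) e := by
    intro e u h2 hu hev
    rcases hx : owner g S e with z | f
    · obtain ⟨hz, hze⟩ := (owner_eq_inl_iff hI).1 hx
      rcases far_unique u.2.1 hc.mem u.2.2 hu hev z hze with rfl | rfl
      · exact hz u.2.1
      · exact hz hc.mem
    · rw [hx] at h2
      obtain ⟨p, hp, q, hq, hpq⟩ := one_lt_card.1 h2
      have : ∀ w ∈ h (Sum.inr f), w = u := by
        intro w hw
        obtain ⟨e', he', hw'⟩ := mem_h.1 hw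
        have h1 := (owner_eq_inr hx).1
        have h2 := (owner_eq_inr he').1
        rw [← h2, h1] at hw'
        exact Subtype.ext ((far_unique u.2.1 hc.mem u.2.2 hu hev w.1 hw').resolve_right w.2.2)
      exact hpq ((this p hp).trans (this q hq).symm)
  have hpick : ∀ x, (h x).Nonempty → ∃ pick : T → E, ∀ u ∈ h x, owner g S (pick u) = x ∧
      Cross g (pt u.1) (pick u) := by
    rintro x ⟨w, hw⟩
    have : ∀ u : T, ∃ e, u ∈ h x → owner g S e = x ∧ Cross g (pt u.1) e := by
      intro u
      by_cases hu : u ∈ h x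
      · obtain ⟨e, he⟩ := mem_h.1 hu
        exact ⟨e, fun _ => he⟩
      · obtain ⟨e, -⟩ := mem_h.1 hw
        exact ⟨e, fun h => absurd h hu⟩
    choose pick hpick using this
    exact ⟨pick, hpick⟩
  have hinl : ∀ z, #(h (Sum.inl z)) ≤ #{e | Cross g (pt z) e ∧ z ∉ S ∧ ¬ Cross g (pt v) e} := by
    intro z
    rcases (h (Sum.inl z)).eq_empty_or_nonempty with hzem | hzne
    · simp [hzem]
    obtain ⟨pick, hpick⟩ := hpick (Sum.inl z) hzne
    have hz : ∀ u ∈ h (Sum.inl z), z ∉ S ∧ Cross g (pt z) (pick u) := fun u hu =>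
      (owner_eq_inl_iff hI).1 (hpick u hu).1
    refine card_le_card_of_injOn pick (fun u hu => ?_) (fun u hu u' hu' huu => ?_)
    · obtain ⟨h1, h2⟩ := hz u hu
      simp only [coe_filter, mem_univ, true_and]
      refine ⟨h2, h1, fun hev => ?_⟩
      rcases far_unique u.2.1 hc.mem u.2.2 (hpick u hu).2 hev z h2 with rfl | rfl
      · exact h1 u.2.1
      · exact h1 hc.mem
    · by_contra hne
      obtain ⟨h1, h2⟩ := hz u hu
      rcases far_unique u.2.1 u'.2.1 (fun hc => hne (Subtype.ext hc)) (hpick u hu).2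
        (huu ▸ (hpick u' hu').2) z h2 with rfl | rfl
      · exact h1 u.2.1
      · exact h1 u'.2.1
  have hinr : ∀ f, #(h (Sum.inr f)) ≤ 2 := by
    intro f
    by_contra! hcon
    obtain ⟨p, q, r, hp, hq, hr, hpq, hpr, hqr⟩ := two_lt_card_iff.1 hcon
    have hin : ∀ w ∈ h (Sum.inr f), Cross g (pt w.1) f := fun w hw => by
      obtain ⟨e, he, hw'⟩ := mem_h.1 hw
      rwa [(owner_eq_inr he).1]
    rcases far_unique p.2.1 q.2.1 (fun hc => hpq (Subtype.ext hc)) (hin p hp) (hin q hq) r.1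
      (hin r hr) with h1 | h1
    · exact hpr (Subtype.ext h1.symm)
    · exact hqr (Subtype.ext h1.symm)
  have hn : ∀ x, κ x = none → #(h x) ≤ 3 := by
    rintro (z | f) -
    · refine (hinl z).trans ?_
      by_cases hz : z ∈ S
      · simp [hz]
      · refine le_trans (card_le_card fun e => ?_) (hd z hz)
        simp only [mem_filter, mem_univ, true_and]
        exact fun h => h.1
    · exact (hinr f).trans (by norm_num)
  have hs : ∀ x, κ x ≠ none → 1 ≤ #(h x) ∧ #(h x) ≤ 2 := by
    intro x hx
    refine ⟨card_pos.2 (hne x hx), ?_⟩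
    rcases x with z | f
    · obtain ⟨e, he, hev⟩ := κ_ne.1 hx
      obtain ⟨hz, hze⟩ := (owner_eq_inl_iff hI).1 he
      have h1 := hinl z
      have h2 := hd z hz
      have h3 : #{e | Cross g (pt z) e ∧ z ∉ S ∧ ¬ Cross g (pt v) e} < cutSize g (pt z) := by
        refine card_lt_card ((ssubset_iff_of_subset fun e' => ?_).2 ⟨e, ?_, ?_⟩)
        · simp only [mem_filter, mem_univ, true_and]
          exact fun h => h.1
        · simpa using hze
        · intro hmem
          exact (mem_filter.1 hmem).2.2.2 hev
      omega
    · exact hinr f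
  have htwo : ∀ i, 2 ≤ #(univ.filter fun x => κ x = some i) := by
    intro i
    refine (hc.two_le i).trans (card_le_card_of_injOn (owner g S) (fun e he => ?_)
      (howner.mono fun e he => ?_))
    · simp only [coe_filter, mem_univ, true_and] at he ⊢
      have := hκ e he.1
      rw [he.2] at this
      exact this
    · simp only [coe_filter, mem_univ, true_and] at he
      exact he.1
  obtain ⟨opt, hopt1, hopt2, hopt3, hopt4⟩ := hypergraph_packing hN h κ hn hs
    (fun Y hY => by convert hcut Y hY) (by convert hdeg) (fun i => by convert htwo i)
  let φ : E → Option (Fin k) := fun e =>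
    if Cross g (pt v) e then some (c e) else
      match κ (owner g S e), opt (owner g S e) with
      | none, none => none
      | none, some (Sum.inl i) => some i
      | none, some (Sum.inr τ) => some τ.2
      | some j, some (Sum.inr τ) => if Cross g (pt τ.1.1) e then some τ.2 else some j
      | some j, _ => some j
  -- the edges available for colour `i` at the terminal `u`
  have hedge : ∀ x (u : T) i, u ∈ h x → (opt x = some (Sum.inr (u, i)) ∨
      (κ x = some i ∧ h x = {u}) ∨ (opt x = some (Sum.inl i) ∧ 2 ≤ #(h x))) →
      ∃ e, owner g S e = x ∧ Cross g (pt u.1) e ∧ φ e = some i := by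
    intro x u i hu hcase
    obtain ⟨e, rfl, he⟩ := mem_h.1 hu
    refine ⟨e, rfl, he, ?_⟩
    rcases hcase with h1 | ⟨h1, h2⟩ | ⟨h1, h2⟩
    · have h3 := hnv (hopt2 _ _ h1).2 he
      simp only [φ, h3, if_false, h1]
      cases κ (owner g S e) <;> simp [he]
    · by_cases hev : Cross g (pt v) e
      · rw [hκ e hev] at h1
        simp only [φ, if_pos hev, h1]
      · simp only [φ, hev, if_false, h1]
        rcases h3 : opt (owner g S e) with - | (j | τ)
        · rfl
        · rfl
        · have := (hopt2 _ _ h3).2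
          simp [h2] at this
    · have h3 := hnv h2 he
      simp only [φ, h3, if_false, h1]
      rcases hopt1 _ _ h1 with h4 | h4 <;> simp [h4]
  have hcol : ∀ i (u : T), ∃ x, u ∈ h x ∧ ((∃ τ, opt x = some (Sum.inr τ)) ∨ #(h x) = 1) ∧
      ∃ e, owner g S e = x ∧ Cross g (pt u.1) e ∧ φ e = some i := by
    intro i u
    rcases hopt4 u i with ⟨x, hx⟩ | ⟨x, hx, hxu⟩
    · have hux := (hopt2 _ _ hx).1
      exact ⟨x, hux, Or.inl ⟨_, hx⟩, hedge x u i hux (Or.inl hx)⟩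
    · have hux : u ∈ h x := by simp [hxu]
      exact ⟨x, hux, Or.inr (by simp [hxu]), hedge x u i hux (Or.inr (Or.inl ⟨hx, hxu⟩))⟩
  refine ⟨φ, ⟨fun e he => if_pos he, ?_, ?_⟩⟩
  · intro i Y hY
    by_cases hsep : ∃ a b : T, Y a.1 ≠ Y b.1
    · obtain ⟨a, b, hab⟩ := hsep
      obtain ⟨x, hx, p, hp, q, hq, hpq⟩ := hopt3 i (fun u => Y u.1) a b hab
      have h2 : 2 ≤ #(h x) := one_lt_card.2 ⟨p, hp, q, hq, fun hc => hpq (by rw [hc])⟩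
      obtain ⟨e, he, hep, heφ⟩ := hedge x p i hp (Or.inr (Or.inr ⟨hx, h2⟩))
      obtain ⟨e', he', heq, heφ'⟩ := hedge x q i hq (Or.inr (Or.inr ⟨hx, h2⟩))
      rcases cross_or_cross_of_owner_eq hI (he.trans he'.symm) p.2.1 q.2.1 hep heq hpq with h3 | h3
      · exact ⟨e, heφ, hnv (by rwa [he]) hep, h3⟩
      · exact ⟨e', heφ', hnv (by rwa [he']) heq, h3⟩
    · push Not at hsep
      obtain ⟨z, hz, hzY⟩ : ∃ z ∈ spanTarget g S v c i, Y z ≠ Y u₀ := by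
        obtain ⟨⟨b, hb, hb'⟩, d, hd, hd'⟩ := hY
        cases hYa : Y u₀
        · exact ⟨b, hb, by simp [hb']⟩
        · exact ⟨d, hd, by simp [hd']⟩
      obtain ⟨hzv, hz⟩ := hz
      have hzS : z ∉ S := fun hzS => hzY (hsep ⟨z, hzS, hzv⟩ ⟨u₀, hu₀, hu₀v⟩)
      obtain ⟨e, hev, hez, hei⟩ := hz.resolve_left hzS
      have hx := (owner_eq_inl_iff hI).2 ⟨hzS, hez⟩
      have hκz : κ (Sum.inl z) = some i := by rw [← hx, hκ e hev, hei]
      have hedge' : ∀ u ∈ h (Sum.inl z), (∀ τ, opt (Sum.inl z) = some (Sum.inr τ) → τ.1 ≠ u) →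
          ∃ e, φ e = some i ∧ ¬ Cross g (pt v) e ∧ Cross g Y e := by
        intro u hu hτ
        obtain ⟨e', he', heu⟩ := mem_h.1 hu
        obtain ⟨-, hez'⟩ := (owner_eq_inl_iff hI).1 he'
        have hzu : u.1 ≠ z := fun hc => hzS (hc ▸ u.2.1)
        obtain ⟨a, ha, hj⟩ := exists_joins hez'
        have hau := ((hj.cross_pt_iff ha).1 heu).resolve_left hzu
        subst hau
        have hev' : ¬ Cross g (pt v) e' := by
          rw [hj.cross_pt_iff ha]
          rintro (h | h)
          · exact hzv h.symm
          · exact u.2.2 h.symm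
        refine ⟨e', ?_, hev', (hj Y).2 ?_⟩
        · simp only [φ, hev', if_false, he', hκz]
          rcases h3 : opt (Sum.inl z) with - | (j | τ)
          · rfl
          · rfl
          · have : ¬ Cross g (pt τ.1.1) e' := by
              rw [hj.cross_pt_iff ha]
              rintro (h | h)
              · exact hzS (h ▸ τ.1.2.1)
              · exact hτ τ h3 (Subtype.ext h)
            simp [this]
        · rw [hsep u ⟨u₀, hu₀, hu₀v⟩]
          exact hzY
      rcases h3 : opt (Sum.inl z) with - | (j | τ)
      · obtain ⟨u, hu⟩ := hne (Sum.inl z) (by simp [hκz])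
        exact hedge' u hu (by simp [h3])
      · obtain ⟨u, hu⟩ := hne (Sum.inl z) (by simp [hκz])
        exact hedge' u hu (by simp [h3])
      · obtain ⟨u, hu, huτ⟩ := exists_mem_ne (hopt2 _ _ h3).2 τ.1
        refine hedge' u hu fun τ' hτ' => ?_
        rw [h3] at hτ'
        obtain rfl : τ = τ' := by simpa using hτ'
        exact huτ.symm
  · intro i u hu huv
    suffices hsuff : ∃ x y, x ≠ y ∧ (∃ e, owner g S e = x ∧ Cross g (pt u) e ∧ φ e = some i) ∧
        ∃ e, owner g S e = y ∧ Cross g (pt u) e ∧ φ e = some i by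
      obtain ⟨x, y, hxy, ⟨e, he, he'⟩, e', h1, h2⟩ := hsuff
      exact one_lt_card.2 ⟨e, by simpa using he', e', by simpa using h2, fun hc =>
        hxy (by rw [← he, ← h1, hc])⟩
    let u' : T := ⟨u, hu, huv⟩
    by_cases hT : ∃ w : T, w ≠ u'
    · obtain ⟨w, hw⟩ := hT
      obtain ⟨x, hux, hx, hex⟩ := hcol i u'
      obtain ⟨y, hy, p, hp, q, hq, hpq⟩ := hopt3 i (fun w => decide (w = u')) w u' (by simp [hw])
      have h2 : 2 ≤ #(h y) := one_lt_card.2 ⟨p, hp, q, hq, fun hc => hpq (by rw [hc])⟩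
      have huy : u' ∈ h y := by
        by_cases h1 : p = u'
        · exact h1 ▸ hp
        · by_cases h2 : q = u'
          · exact h2 ▸ hq
          · simp [h1, h2] at hpq
      refine ⟨x, y, ?_, hex, hedge y u' i huy (Or.inr (Or.inr ⟨hy, h2⟩))⟩
      rintro rfl
      rcases hx with ⟨τ, hτ⟩ | hx
      · rw [hy] at hτ
        simp at hτ
      · omega
    · push Not at hT
      obtain ⟨x, hx, y, hy, hxy⟩ := one_lt_card.1 (htwo i)
      simp only [mem_filter, mem_univ, true_and] at hx hy
      have hsingle : ∀ x, κ x = some i → h x = {u'} := fun x hx => by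
        obtain ⟨w, hw⟩ := hne x (by simp [hx])
        ext w'
        rw [mem_singleton]
        exact ⟨fun _ => hT w', fun hc => by rw [hc, ← hT w]; exact hw⟩
      exact ⟨x, y, hxy, hedge x u' i (by simp [hsingle x hx]) (Or.inr (Or.inl ⟨hx, hsingle x hx⟩)),
        hedge y u' i (by simp [hsingle y hy]) (Or.inr (Or.inl ⟨hy, hsingle y hy⟩))⟩

end Base

section Extension

variable {V E : Type*} [Finite V] [Fintype E] {k N : ℕ}

/-- A colouring of the edges at a terminal of degree `N ≥ 7 k` that uses every colour at least
twice extends to a packing. -/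
theorem IsColoring.exists_extension (hk : 0 < k) (hN : 7 * k ≤ N) {g : E → V × V} {S : Set V}
    {v : V} {c : E → Fin k} (hc : IsColoring g S v c N) : ∃ φ, IsExtension g S v c φ := by
  have := Fintype.ofFinite V
  induction hn : numNonloop g using Nat.strong_induction_on generalizing g S v c with
  | _ n ih =>
    by_contra hbad
    have hb : IsMinimalBad g S v c N :=
      { hc with
        ih := fun g' hg' S v c hc' => ih _ (hn ▸ hg') hc' rfl
        bad := hbad
        k_pos := hk
        N_le := hN }
    exact hbad (hc.exists_extension_of_deg_le_three hN (fun e p q => hb.mem_of_joins)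
      (fun z hz => hb.deg_le_three hz))

open Finset in
/-- Extension of a precolouring of the edges at a nonterminal `v` of small degree. -/
theorem CutConn.exists_extension_at_nonterminal (hk : 0 < k) (hN : 7 * k ≤ N) {g : E → V × V}
    {S : Set V} (hS : S.Nonempty) {v : V} (hv : v ∉ S) (hc : CutConn g S N)
    (hvcut : ∀ Y : V → Bool, Y v = true → (∀ s ∈ S, Y s = false) → cutSize g (pt v) ≤ cutSize g Y)
    (hvN : cutSize g (pt v) + 2 * k ≤ N) (ψ : E → Option (Fin k)) :
    ∃ φ : E → Option (Fin k), (∀ e i, Cross g (pt v) e → ψ e = some i → φ e = some i) ∧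
      ∀ i (Y : V → Bool), Sep {u | u ≠ v ∧ (u ∈ S ∨ ∃ e, Cross g (pt v) e ∧ Cross g (pt u) e ∧
        ψ e = some i)} Y → ∃ e, φ e = some i ∧ ¬ Cross g (pt v) e ∧ Cross g Y e := by
  classical
  obtain ⟨s₀, hs₀⟩ := hS
  have hsv : s₀ ≠ v := fun h => hv (h ▸ hs₀)
  set m := N - cutSize g (pt v) with hm
  let g' : E ⊕ Fin m → V × V := Sum.elim g fun _ => (v, s₀)
  have hcut : ∀ Y, cutSize g' Y = cutSize g Y + if Y v ≠ Y s₀ then m else 0 := by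
    intro Y
    simp only [cutSize, card_filter, Fintype.sum_sum_type]
    congr 1
    change (∑ _ : Fin m, if Y v ≠ Y s₀ then 1 else 0) = _
    split_ifs <;> simp
  let c : E ⊕ Fin m → Fin k := Sum.elim (fun e => (ψ e).getD ⟨0, hk⟩)
    fun j => ⟨j % k, Nat.mod_lt _ hk⟩
  have hcol : IsColoring g' (insert v S) v c N :=
    { mem := Set.mem_insert _ _
      exists_ne := ⟨s₀, Set.mem_insert_of_mem _ hs₀, hsv⟩
      conn := by
        intro Y hY
        wlog hYv : Y v = true generalizing Y
        · have := this _ hY.not (by simpa using hYv)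
          rwa [cutSize_not] at this
        rw [hcut]
        by_cases hsep : Sep S Y
        · exact (hc Y hsep).trans (Nat.le_add_right _ _)
        · obtain ⟨-, b, hb, hbY⟩ := hY
          have hbS : b ∈ S := (Set.mem_insert_iff.1 hb).resolve_left
            (fun h => by rw [h, hYv] at hbY; simp at hbY)
          have hall : ∀ s ∈ S, Y s = false := fun s hs => by
            by_contra hne
            exact hsep (Sep.of_ne hs hbS (by rw [hbY]; exact hne))
          have := hvcut Y hYv hall
          rw [if_pos (by rw [hYv, hall _ hs₀]; simp)]
          omega
      deg := by
        rw [hcut, if_pos (by simp [pt, hsv])]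
        omega
      two_le := by
        intro i
        have hi := i.2
        refine one_lt_card.2 ⟨Sum.inr ⟨i, by omega⟩, ?_, Sum.inr ⟨i + k, by omega⟩, ?_, ?_⟩
        · simp [g', c, Cross, pt, hsv, Fin.ext_iff, Nat.mod_eq_of_lt hi]
        · simp [g', c, Cross, pt, hsv, Fin.ext_iff, Nat.mod_eq_of_lt hi]
        · simp only [ne_eq, Sum.inr.injEq, Fin.mk.injEq]
          omega }
  obtain ⟨φ, hφ⟩ := hcol.exists_extension hk hN
  refine ⟨fun e => φ (Sum.inl e), fun e i he hi => ?_, fun i Y hY => ?_⟩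
  · have := hφ.extends_at (Sum.inl e) he
    simpa [c, hi] using this
  · obtain ⟨e, he, hev, heY⟩ := hφ.connects i Y (by
      obtain ⟨⟨a, ha, ha'⟩, b, hb, hb'⟩ := hY
      have key : ∀ u, (u ≠ v ∧ (u ∈ S ∨ ∃ e, Cross g (pt v) e ∧ Cross g (pt u) e ∧
          ψ e = some i)) → u ∈ spanTarget g' (insert v S) v c i := by
        rintro u ⟨huv, hu | ⟨e, h1, h2, h3⟩⟩
        · exact ⟨huv, Or.inl (Set.mem_insert_of_mem _ hu)⟩
        · exact ⟨huv, Or.inr ⟨Sum.inl e, h1, h2, by simp [c, h3]⟩⟩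
      exact ⟨⟨a, key a ha, ha'⟩, b, key b hb, hb'⟩)
    rcases e with e | j
    · exact ⟨e, he, hev, heY⟩
    · exact absurd (show Cross g' (pt v) (Sum.inr j) by simp [g', Cross, pt, hsv]) hev

/-- The colour classes of `φ` connect the set `S`. -/
def Packs (g : E → V × V) (φ : E → Option (Fin k)) (S : Set V) : Prop :=
  ∀ i Y, Sep S Y → ∃ e, φ e = some i ∧ Cross g Y e

theorem CutConn.exists_packs (hk : 0 < k) (hN : 7 * k ≤ N) {g : E → V × V} {S : Set V}
    (hS : S.Nonempty) (hc : CutConn g S N) : ∃ φ : E → Option (Fin k), Packs g φ S := by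
  let g' : E → Option V × Option V := fun e => (some (g e).1, some (g e).2)
  have hg' : ∀ e, g' e = (some (g e).1, some (g e).2) := fun _ => rfl
  have hno : ∀ e, ¬ Cross g' (pt none) e := fun e => by simp [hg', Cross, pt]
  have hzero : cutSize g' (pt none) = 0 := by
    simp [cutSize, hno]
  obtain ⟨φ, -, hφ⟩ := CutConn.exists_extension_at_nonterminal (g := g') (S := some '' S)
    (v := none) hk hN (hS.image _) (by simp)
    (by
      rintro Y ⟨⟨_, ⟨a, ha, rfl⟩, ha'⟩, _, ⟨b, hb, rfl⟩, hb'⟩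
      exact hc (fun w => Y (some w)) ⟨⟨a, ha, ha'⟩, b, hb, hb'⟩)
    (fun Y _ _ => by rw [hzero]; exact Nat.zero_le _) (by omega) (fun _ => none)
  refine ⟨φ, fun i Y hY => ?_⟩
  obtain ⟨⟨a, ha, ha'⟩, b, hb, hb'⟩ := hY
  obtain ⟨e, he, -, heY⟩ := hφ i (fun w => w.elim false Y)
    ⟨⟨some a, ⟨by simp, Or.inl ⟨a, ha, rfl⟩⟩, ha'⟩, some b, ⟨by simp, Or.inl ⟨b, hb, rfl⟩⟩, hb'⟩
  exact ⟨e, he, heY⟩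

end Extension

theorem Packs.mono {V E : Type*} {k : ℕ} {g : E → V × V} {φ : E → Option (Fin k)} {S S' : Set V}
    (h : Packs g φ S) (hss : S' ⊆ S) : Packs g φ S' := by
  rintro i Y ⟨⟨a, ha, ha'⟩, b, hb, hb'⟩
  exact h i Y ⟨⟨a, hss ha, ha'⟩, b, hss hb, hb'⟩

section Groups

variable {V E ι : Type*} [Finite V] [Fintype E] {k : ℕ}

/-- A packing of the groups on one side of a small cut combines with a packing of the group on the
other side. -/
theorem exists_packs_of_isolated_group (hk : 0 < k) {g : E → V × V} {S : Set V}
    {𝒜 : Set (Set V)} (hS : S.Nonempty) (hSc : CutConn g S (9 * k)) {X : V → Bool}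
    (hXS : ∀ w ∈ S, X w = true) (hX𝒜 : ∀ A ∈ 𝒜, ∀ w ∈ A, X w = false)
    (h𝒜 : ∃ A ∈ 𝒜, A.Nonempty)
    (hmin : ∀ Y, Sep (S ∪ ⋃₀ 𝒜) Y → cutSize g X ≤ cutSize g Y) (hXk : cutSize g X < 7 * k)
    (hpack : ∀ f : V → V, (∀ A ∈ 𝒜, ∀ w ∈ A, f w = w) →
      ∃ φ : E → Option (Fin k), ∀ A ∈ 𝒜, Packs (mapEnds f g) φ A) :
    ∃ φ : E → Option (Fin k), Packs g φ S ∧ ∀ A ∈ 𝒜, Packs g φ A := by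
  classical
  obtain ⟨a, ha⟩ := hS
  obtain ⟨A₀, hA₀, v, hv⟩ := h𝒜
  have hXa := hXS a ha
  have hXv := hX𝒜 A₀ hA₀ v hv
  have hav : a ≠ v := fun h => by simp [h, hXv] at hXa
  let f1 : V → V := fun w => if X w then a else w
  let f2 : V → V := fun w => if X w then w else v
  have f2v : pt v ∘ f2 = fun w => !X w := by
    ext w
    by_cases hw : X w
    · have : w ≠ v := fun h => by simp [h, hXv] at hw
      simp [f2, hw, pt, this]
    · simp [f2, hw]
  have f2u : ∀ u, X u = true → pt u ∘ f2 = pt u := fun u hu => by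
    ext w
    by_cases hw : X w
    · simp [f2, hw]
    · have h1 : w ≠ u := fun h => hw (h ▸ hu)
      have h2 : v ≠ u := fun h => by simp [← h, hXv] at hu
      simp [f2, hw, pt, h1, h2]
  obtain ⟨φ1, hφ1⟩ := hpack f1 (fun A hA w hw => by simp [f1, hX𝒜 A hA w hw])
  have hf2v : cutSize (mapEnds f2 g) (pt v) = cutSize g X := by
    rw [cutSize_mapEnds, f2v, cutSize_not]
  obtain ⟨φ2, ext2, hφ2⟩ := CutConn.exists_extension_at_nonterminal (g := mapEnds f2 g) (S := S)
    (v := v) (N := 9 * k) hk (by omega) ⟨a, ha⟩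
    (fun h => by rw [hXS v h] at hXv; simp at hXv)
    (hSc.mapEnds f2 (fun u hu => by simp [f2, hXS u hu]) subset_rfl)
    (fun Y hYv hYS => by
      rw [hf2v, cutSize_mapEnds]
      refine hmin _ ⟨⟨v, Or.inr ⟨A₀, hA₀, hv⟩, ?_⟩, a, Or.inl ha, ?_⟩
      · simp [f2, hXv, hYv]
      · simp [f2, hXa, hYS a ha])
    (by omega) φ1
  simp only [cross_mapEnds, f2v, cross_not] at ext2 hφ2
  let φ : E → Option (Fin k) := fun e => if X (g e).1 || X (g e).2 then φ2 e else φ1 e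
  have hφ_out : ∀ e i, (X (g e).1 = false ∨ X (g e).2 = false) → φ1 e = some i → φ e = some i := by
    intro e i he h1
    by_cases hcr : Cross g X e
    · have : X (g e).1 = true ∨ X (g e).2 = true := by
        cases h1 : X (g e).1 <;> cases h2 : X (g e).2 <;> simp_all
      simp [φ, this, ext2 e i hcr h1]
    · have : X (g e).1 = false ∧ X (g e).2 = false := by
        cases h1 : X (g e).1 <;> cases h2 : X (g e).2 <;> simp_all
      simp [φ, this, h1]
  have hφ_in : ∀ (i : Fin k) (Y : V → Bool), (∃ e, φ2 e = some i ∧ ¬ Cross g X e ∧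
      Cross g (Y ∘ f2) e) → ∃ e, φ e = some i ∧ Cross g Y e := by
    rintro i Y ⟨e, he, hev, heY⟩
    have hin : X (g e).1 = true ∧ X (g e).2 = true := by
      by_contra hno
      have : X (g e).1 = false ∧ X (g e).2 = false := by
        cases h1 : X (g e).1 <;> cases h2 : X (g e).2 <;> simp_all
      simp [Cross, f2, this] at heY
    exact ⟨e, by simp [φ, hin, he], by simpa [Cross, f2, hin] using heY⟩
  refine ⟨φ, fun i Y hY => hφ_in i Y (hφ2 i Y ?_), fun A hA i Y hY => ?_⟩
  · obtain ⟨⟨p, hp, hp'⟩, q, hq, hq'⟩ := hY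
    have hne : ∀ w ∈ S, w ≠ v := fun w hw hc => by rw [← hc, hXS w hw] at hXv; simp at hXv
    exact ⟨⟨p, ⟨hne p hp, Or.inl hp⟩, hp'⟩, q, ⟨hne q hq, Or.inl hq⟩, hq'⟩
  · by_cases hsep : Sep {u | u ≠ v ∧ (u ∈ S ∨ ∃ e, Cross g X e ∧
        Cross g (pt u ∘ f2) e ∧ φ1 e = some i)} Y
    · exact hφ_in i Y (hφ2 i Y hsep)
    · have hconst : ∀ u, X u = true → (∃ e, Cross g X e ∧ Cross g (pt u) e ∧ φ1 e = some i) →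
          Y u = Y a := by
        rintro u hu ⟨e, h1, h2, h3⟩
        by_contra hne
        refine hsep (Sep.of_ne (a := u) (b := a) ⟨fun hc => ?_, Or.inr ⟨e, h1, ?_, h3⟩⟩
          ⟨hav, Or.inl ha⟩ hne)
        · rw [hc, hXv] at hu
          simp at hu
        · rwa [f2u u hu]
      let Y1 : V → Bool := fun w => if X w then Y a else Y w
      have hY1f : Y1 ∘ f1 = Y1 := by
        ext w
        by_cases hw : X w <;> simp [Y1, f1, hw, hXa]
      have hY1A : ∀ w ∈ A, Y1 w = Y w := fun w hw => by simp [Y1, hX𝒜 A hA w hw]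
      obtain ⟨⟨p, hp, hp'⟩, q, hq, hq'⟩ := hY
      obtain ⟨e, he, heY⟩ := hφ1 A hA i Y1
        ⟨⟨p, hp, by rw [hY1A p hp, hp']⟩, q, hq, by rw [hY1A q hq, hq']⟩
      rw [cross_mapEnds, hY1f] at heY
      have hnin : X (g e).1 = false ∨ X (g e).2 = false := by
        by_contra! hno
        simp [Cross, Y1, hno] at heY
      refine ⟨e, hφ_out e i hnin he, ?_⟩
      have hYY : ∀ w, (X w = true → Cross g (pt w) e ∧ Cross g X e) → Y1 w = Y w := by
        intro w hw
        cases hXw : X w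
        · simp [Y1, hXw]
        · simp only [Y1, hXw, if_true]
          obtain ⟨h1, h2⟩ := hw hXw
          exact (hconst w hXw ⟨e, h2, h1, he⟩).symm
      have hne := heY.ne
      have e1 := hYY (g e).1 (fun h => by
        have : X (g e).2 = false := by simpa [h] using hnin
        exact ⟨cross_pt.2 (Or.inl ⟨rfl, hne.symm⟩), by simp [Cross, h, this]⟩)
      have e2 := hYY (g e).2 (fun h => by
        have : X (g e).1 = false := by simpa [h] using hnin
        exact ⟨cross_pt.2 (Or.inr ⟨hne, rfl⟩), by simp [Cross, h, this]⟩)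
      rwa [Cross, e1, e2] at heY

open Finset in
/-- At most three groups, each of which is `9 k`-edge-connected, can be packed `k` times. -/
theorem exists_packs_of_card_le_three (hk : 0 < k) (g : E → V × V) (A : ι → Set V) (I : Finset ι)
    (hI : #I ≤ 3) (hne : ∀ i ∈ I, (A i).Nonempty) (hc : ∀ i ∈ I, CutConn g (A i) (9 * k)) :
    ∃ φ : E → Option (Fin k), ∀ i ∈ I, Packs g φ (A i) := by
  classical
  induction hn : #I using Nat.strong_induction_on generalizing g I with
  | _ n ih =>
    set U : Set V := {w | ∃ i ∈ I, w ∈ A i} with hU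
    rcases I.eq_empty_or_nonempty with rfl | ⟨j, hj⟩
    · exact ⟨fun _ => none, by simp⟩
    by_cases hconn : CutConn g U (7 * k)
    · obtain ⟨w, hw⟩ := hne j hj
      obtain ⟨φ, hφ⟩ := hconn.exists_packs hk le_rfl ⟨w, show w ∈ U from ⟨j, hj, hw⟩⟩
      exact ⟨φ, fun i hi => hφ.mono (show A i ⊆ U from fun w hw => ⟨i, hi, hw⟩)⟩
    · simp only [CutConn, not_forall, not_le] at hconn
      obtain ⟨Y₀, hY₀, hlt⟩ := hconn
      obtain ⟨X, hX, hmin⟩ := Set.exists_min_image {Y | Sep U Y} (cutSize g) (Set.toFinite _)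
        ⟨Y₀, hY₀⟩
      have hX7 : cutSize g X < 7 * k := (hmin Y₀ hY₀).trans_lt hlt
      -- some side of the cut contains exactly one group
      obtain ⟨X, i₀, hi₀, hX, hmin, hX7, hXi₀, hXI⟩ : ∃ X : V → Bool, ∃ i₀ ∈ I, Sep U X ∧
          (∀ Y, Sep U Y → cutSize g X ≤ cutSize g Y) ∧ cutSize g X < 7 * k ∧
          (∀ w ∈ A i₀, X w = true) ∧ ∀ i ∈ I, i ≠ i₀ → ∀ w ∈ A i, X w = false := by
        have hside : ∀ i ∈ I, ∃ s : Bool, ∀ w ∈ A i, X w = s := by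
          intro i hi
          obtain ⟨w, hw⟩ := hne i hi
          refine ⟨X w, fun w' hw' => ?_⟩
          by_contra hww
          have := hc i hi X (Sep.of_ne hw' hw hww)
          omega
        choose! s hs using hside
        obtain ⟨⟨p, ⟨i, hi, hpi⟩, hp⟩, q, ⟨i', hi', hqi⟩, hq⟩ := hX
        have hX' : Sep U X := ⟨⟨p, ⟨i, hi, hpi⟩, hp⟩, q, ⟨i', hi', hqi⟩, hq⟩
        have hcard := card_filter_add_card_filter_not (s := I) (fun i => s i = true)
        simp only [Bool.not_eq_true] at hcard
        have hpos1 : i ∈ I.filter fun i => s i = true :=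
          mem_filter.2 ⟨hi, by rw [← hs i hi p hpi, hp]⟩
        have hpos2 : i' ∈ I.filter fun i => s i = false :=
          mem_filter.2 ⟨hi', by rw [← hs i' hi' q hqi, hq]⟩
        have h1 := card_pos.2 ⟨i, hpos1⟩
        have h2 := card_pos.2 ⟨i', hpos2⟩
        have hor : #(I.filter fun i => s i = true) ≤ 1 ∨ #(I.filter fun i => s i = false) ≤ 1 := by
          omega
        rcases hor with hle | hle
        · refine ⟨X, i, hi, hX', hmin, hX7, fun w hw => ?_, fun l hl hli w hw => ?_⟩
          · rw [hs i hi w hw]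
            exact (mem_filter.1 hpos1).2
          · rw [hs l hl w hw]
            by_contra hsl
            exact hli (card_le_one.1 hle _ (mem_filter.2 ⟨hl, by simpa using hsl⟩) _ hpos1)
        · refine ⟨fun w => !X w, i', hi', hX'.not, ?_, by rwa [cutSize_not], fun w hw => ?_,
            fun l hl hli w hw => ?_⟩
          · rw [cutSize_not]
            exact hmin
          · change (!X w) = true
            rw [hs i' hi' w hw, (mem_filter.1 hpos2).2]
            rfl
          · change (!X w) = false
            rw [hs l hl w hw, Bool.not_eq_false']
            by_contra hsl
            exact hli (card_le_one.1 hle _ (mem_filter.2 ⟨hl, by simpa using hsl⟩) _ hpos2)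
      obtain ⟨φ, hφ, hφ'⟩ := exists_packs_of_isolated_group (𝒜 := A '' (I.erase i₀)) hk (hne i₀ hi₀)
        (hc i₀ hi₀) hXi₀
        (by
          rintro _ ⟨i, hi, rfl⟩
          exact hXI i (mem_of_mem_erase hi) (ne_of_mem_erase hi))
        (by
          obtain ⟨q, ⟨i, hi, hqi⟩, hq⟩ := hX.2
          refine ⟨A i, ⟨i, ?_, rfl⟩, q, hqi⟩
          refine mem_coe.2 (mem_erase.2 ⟨?_, hi⟩)
          rintro rfl
          rw [hXi₀ q hqi] at hq
          simp at hq)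
        (by
          have hsub : A i₀ ∪ ⋃₀ (A '' (I.erase i₀)) ⊆ U := by
            rintro w (hw | ⟨_, ⟨i, hi, rfl⟩, hw⟩)
            · exact ⟨i₀, hi₀, hw⟩
            · exact ⟨i, mem_of_mem_erase hi, hw⟩
          rintro Y ⟨⟨p, hp, hp'⟩, q, hq, hq'⟩
          exact hmin Y ⟨⟨p, hsub hp, hp'⟩, q, hsub hq, hq'⟩)
        hX7
        (by
          intro f hf
          have hlt : #(I.erase i₀) < #I := card_erase_lt_of_mem hi₀
          obtain ⟨φ, hφ⟩ := ih _ (hn ▸ hlt) (mapEnds f g) (I.erase i₀) (by omega)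
            (fun i hi => hne i (mem_of_mem_erase hi))
            (fun i hi => (hc i (mem_of_mem_erase hi)).mapEnds f
              (hf (A i) ⟨i, hi, rfl⟩) subset_rfl) rfl
          refine ⟨φ, ?_⟩
          rintro _ ⟨i, hi, rfl⟩
          exact hφ i hi)
      refine ⟨φ, fun i hi => ?_⟩
      by_cases h : i = i₀
      · exact h ▸ hφ
      · exact hφ' (A i) ⟨i, mem_coe.2 (mem_erase.2 ⟨h, hi⟩), rfl⟩

end Groups

section Translation

theorem IsWalk.exists_cross {ends : E → Sym2 V} {g : E → V × V}
    (hg : ∀ e, ends e = s((g e).1, (g e).2)) {a b : V} {l : List E} (h : IsWalk ends a b l)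
    {Y : V → Bool} (hab : Y a ≠ Y b) : ∃ e ∈ l, Cross g Y e := by
  induction h with
  | nil v => exact absurd rfl hab
  | @cons u v w e l he _ ih =>
    by_cases huv : Y u = Y v
    · obtain ⟨e', he', hY⟩ := ih (huv ▸ hab)
      exact ⟨e', List.mem_cons_of_mem _ he', hY⟩
    · refine ⟨e, List.mem_cons_self, ?_⟩
      rw [hg, Sym2.eq_iff] at he
      rcases he with ⟨h1, h2⟩ | ⟨h1, h2⟩
      · rw [Cross, h1, h2]
        exact huv
      · rw [Cross, h1, h2]
        exact Ne.symm huv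

theorem EdgeConnectedIn.cutConn [Fintype E] {ends : E → Sym2 V} {g : E → V × V}
    (hg : ∀ e, ends e = s((g e).1, (g e).2)) {F : Set E} {S : Set V} {n : ℕ}
    (h : EdgeConnectedIn ends F S n) : CutConn g S n := by
  rintro Y ⟨⟨a, ha, hYa⟩, b, hb, hYb⟩
  have hab : Y a ≠ Y b := by simp [hYa, hYb]
  obtain ⟨P, hP, hdisj⟩ := h a ha b hb fun h => hab (h ▸ rfl)
  choose f hfP hf using fun i => (hP i).1.exists_cross hg hab
  have hinj : Function.Injective f := by
    intro i j hij
    by_contra hne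
    exact hdisj i j hne (f i) (hfP i) (hij ▸ hfP j)
  simpa [cutSize] using Finset.card_le_card_of_injOn (s := Finset.univ)
    (t := Finset.univ.filter fun e => Cross g Y e) f (fun i _ => by simpa using hf i) hinj.injOn

theorem Packs.connectsSet {ends : E → Sym2 V} {g : E → V × V}
    (hg : ∀ e, ends e = s((g e).1, (g e).2)) {k : ℕ} {φ : E → Option (Fin k)} {S : Set V}
    (h : Packs g φ S) (i : Fin k) : ConnectsSet ends {e | φ e = some i} S := by
  classical
  intro a ha b hb
  by_contra hab
  obtain ⟨e, he, hY⟩ := h i (fun w => decide (Reaches ends {e | φ e = some i} a w))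
    ⟨⟨a, ha, decide_eq_true Relation.ReflTransGen.refl⟩, b, hb, by simpa using hab⟩
  have hstep : ∀ p q, ends e = s(p, q) → Reaches ends {e | φ e = some i} a p →
      Reaches ends {e | φ e = some i} a q := fun p q hpq hp => hp.tail ⟨e, he, hpq⟩
  exact hY (decide_eq_decide.2 ⟨hstep _ _ (hg e), hstep _ _ ((hg e).trans Sym2.eq_swap)⟩)

end Translation

/-- If `S1, S2, S3` are pairwise vertex-disjoint subsets of a
loopless multigraph `G`, each `9k`-edge-connected in `G`, then there is a
packing of `k` pairwise edge-disjoint `(S1, S2, S3)`-forests in `G`. -/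
theorem three_groups_packing {V E : Type} [Fintype V] [Fintype E]
    (ends : E → Sym2 V) (hG : Loopless ends) (k : ℕ) (hk : 0 < k)
    (S1 S2 S3 : Set V)
    (h12 : Disjoint S1 S2) (h13 : Disjoint S1 S3) (h23 : Disjoint S2 S3)
    (hc1 : EdgeConnectedIn ends Set.univ S1 (9 * k))
    (hc2 : EdgeConnectedIn ends Set.univ S2 (9 * k))
    (hc3 : EdgeConnectedIn ends Set.univ S3 (9 * k)) :
    ∃ H : Fin k → Set E, PairwiseEdgeDisjoint H ∧
      ∀ i, ConnectsSet ends (H i) S1 ∧ ConnectsSet ends (H i) S2 ∧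
        ConnectsSet ends (H i) S3 := by
  classical
  have hrep : ∀ e, ∃ p : V × V, ends e = s(p.1, p.2) := fun e =>
    Sym2.ind (f := fun z => ∃ p : V × V, z = s(p.1, p.2)) (fun a b => ⟨(a, b), rfl⟩) (ends e)
  choose g hg using hrep
  let A : Fin 3 → Set V := ![S1, S2, S3]
  have hA : ∀ i, EdgeConnectedIn ends Set.univ (A i) (9 * k) := by
    intro i
    fin_cases i
    exacts [hc1, hc2, hc3]
  obtain ⟨φ, hφ⟩ := exists_packs_of_card_le_three hk g A
    (Finset.univ.filter fun i => (A i).Nonempty) (Finset.card_le_univ _)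
    (fun i hi => (Finset.mem_filter.1 hi).2) (fun i _ => (hA i).cutConn hg)
  have hconn : ∀ j i, ConnectsSet ends {e | φ e = some i} (A j) := by
    intro j i a ha
    exact (hφ j (Finset.mem_filter.2 ⟨Finset.mem_univ _, a, ha⟩)).connectsSet hg i a ha
  refine ⟨fun i => {e | φ e = some i}, ?_, fun i => ⟨hconn 0 i, hconn 1 i, hconn 2 i⟩⟩
  intro i j hij
  refine Set.disjoint_left.2 fun e hi hj => hij ?_
  exact Option.some_injective _ (Eq.trans (Eq.symm hi) hj)

end SteinerPacking
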